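/- arXiv:2204.12925 — 4 statements merged into one kernel-verified Lean document; each statement's English description precedes it below -/
import Mathlib

section
/- Let a be a nonzero complex number, and let Z = {ρ ∈ ℂ : Γ(ρ) = a} be the set of solutions of the equation Γ(z) = a. For ρ ∈ Z let k_ρ denote the order of ρ as a zero of the analytic function z ↦ Γ(z) − a. Then the series ∑_{ρ∈Z} k_ρ/ρ² converges absolutely and ∑_{ρ∈Z} k_ρ/ρ² = 2aγ + a², where γ is the Euler–Mascheroni constant. -/
open Complex Real

lemma aux_divide (f : ℂ → ℂ) (hf : Differentiable ℂ f) (ρ : ℂ) (hρ : ρ ≠ 0) (n : ℕ)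
    (hn : analyticOrderAt f ρ = (n : ℕ∞)) :
    ∃ g : ℂ → ℂ, Differentiable ℂ g ∧ g ρ ≠ 0 ∧ ∀ z, f z = (1 - z / ρ) ^ n * g z := by
  classical
  obtain ⟨g, hga, hg0, hg⟩ := (hf.analyticAt ρ).analyticOrderAt_eq_natCast.1 hn
  have hc : ((-ρ) ^ n : ℂ) ≠ 0 := pow_ne_zero _ (neg_ne_zero.2 hρ)
  have key : ∀ z, (1 - z / ρ) ^ n * (-ρ) ^ n = (z - ρ) ^ n := by
    intro z
    rw [← mul_pow]; congr 1; field_simp; ring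
  have hfρ : f ρ = (ρ - ρ) ^ n * g ρ := by simpa using hg.self_of_nhds
  let G : ℂ → ℂ := fun z => if z = ρ then (-ρ) ^ n * g ρ else f z / (1 - z / ρ) ^ n
  have hne : ∀ z, z ≠ ρ → (1 - z / ρ) ≠ 0 := by
    intro z hz h
    apply hz
    field_simp at h
    rw [mul_zero] at h
    exact (sub_eq_zero.1 h).symm
  refine ⟨G, ?_, ?_, ?_⟩
  · intro z
    by_cases hz : z = ρ
    · subst hz
      have : G =ᶠ[nhds z] fun w => (-z) ^ n * g w := by
        filter_upwards [hg] with w hw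
        by_cases hwz : w = z
        · simp [G, hwz]
        · simp only [G, hwz, if_false]
          rw [hw, ← key w, smul_eq_mul, div_eq_iff (pow_ne_zero _ (hne w hwz))]
          ring
      exact (hga.differentiableAt.const_mul _).congr_of_eventuallyEq this
    · have : G =ᶠ[nhds z] fun w => f w / (1 - w / ρ) ^ n := by
        filter_upwards [isOpen_ne.mem_nhds hz] with w hw
        simp [G, show w ≠ ρ from hw]
      refine DifferentiableAt.congr_of_eventuallyEq ?_ this
      refine (hf z).div (by fun_prop) (pow_ne_zero _ (hne z hz))
  · simp [G, hg0, hρ]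
  · intro z
    by_cases hz : z = ρ
    · simp only [G, hz, if_true]
      rw [← mul_assoc, key, hfρ]
    · simp only [G, hz, if_false]
      rw [mul_div_cancel₀ _ (pow_ne_zero _ (hne z hz))]

lemma aux_D_mul (f g : ℂ → ℂ) (hf : Differentiable ℂ f) (hg : Differentiable ℂ g)
    (hf0 : f 0 ≠ 0) (hg0 : g 0 ≠ 0) :
    deriv (logDeriv (fun z => f z * g z)) 0 = deriv (logDeriv f) 0 + deriv (logDeriv g) 0 := by
  have h : logDeriv (fun z => f z * g z) =ᶠ[nhds 0] fun z => logDeriv f z + logDeriv g z := by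
    filter_upwards [hf.continuous.continuousAt.eventually_ne hf0,
      hg.continuous.continuousAt.eventually_ne hg0] with z h1 h2
    exact logDeriv_mul z h1 h2 (hf z) (hg z)
  rw [h.deriv_eq]
  have d : ∀ f : ℂ → ℂ, Differentiable ℂ f → f 0 ≠ 0 → DifferentiableAt ℂ (logDeriv f) 0 := by
    intro f hf hf0
    exact (hf.analyticAt 0).deriv.differentiableAt.div (hf 0) hf0
  exact deriv_fun_add (d f hf hf0) (d g hg hg0)

lemma aux_D_lin (ρ : ℂ) (hρ : ρ ≠ 0) (n : ℕ) :
    deriv (logDeriv (fun z : ℂ => (1 - z / ρ) ^ n)) 0 = - (n / ρ ^ 2) := by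
  have h : logDeriv (fun z : ℂ => (1 - z / ρ) ^ n) = fun z => n * (-(1 / ρ) / (1 - z / ρ)) := by
    funext z
    rw [logDeriv_fun_pow (by fun_prop), logDeriv_apply]
    congr 2
    simp
  rw [h]
  have : HasDerivAt (fun z : ℂ => (n : ℂ) * (-(1 / ρ) / (1 - z / ρ)))
      (n * ((0 * (1 - 0 / ρ) - (-(1 / ρ)) * (-(1 / ρ))) / (1 - 0 / ρ) ^ 2)) 0 := by
    refine (HasDerivAt.div (hasDerivAt_const _ _) ?_ (by simp)).const_mul _
    exact ((hasDerivAt_id (0 : ℂ)).div_const ρ).const_sub 1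
  rw [this.deriv]
  simp
  field_simp

lemma aux_factor (f : ℂ → ℂ) (hf : Differentiable ℂ f) (hf0 : f 0 = 1) (k : ℂ → ℕ)
    (S : Finset ℂ) (hS : ∀ ρ ∈ S, ρ ≠ 0 ∧ analyticOrderAt f ρ = (k ρ : ℕ∞)) :
    ∃ g : ℂ → ℂ, Differentiable ℂ g ∧ g 0 = 1 ∧ (∀ ρ ∈ S, g ρ ≠ 0) ∧
      (∀ z, f z = (∏ ρ ∈ S, (1 - z / ρ) ^ k ρ) * g z) ∧
      deriv (logDeriv g) 0 = deriv (logDeriv f) 0 + ∑ ρ ∈ S, (k ρ : ℂ) / ρ ^ 2 := by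
  classical
  induction S using Finset.induction_on with
  | empty => exact ⟨f, hf, hf0, by simp, by simp, by simp⟩
  | insert σ S hσ ih =>
    obtain ⟨g, hg, hg0, hgS, hfg, hD⟩ := ih (fun ρ h => hS ρ (Finset.mem_insert_of_mem h))
    obtain ⟨hσ0, hord⟩ := hS σ (Finset.mem_insert_self _ _)
    let P : ℂ → ℂ := fun z => ∏ ρ ∈ S, (1 - z / ρ) ^ k ρ
    have hP : Differentiable ℂ P := by
      simp only [P]; fun_prop
    have hPσ : P σ ≠ 0 := by
      refine Finset.prod_ne_zero_iff.2 fun ρ hρ => pow_ne_zero _ ?_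
      have hρ0 := (hS ρ (Finset.mem_insert_of_mem hρ)).1
      intro h
      field_simp at h
      rw [mul_zero] at h
      have : ρ = σ := sub_eq_zero.1 h
      exact hσ (this ▸ hρ)
    have hord' : analyticOrderAt g σ = (k σ : ℕ∞) := by
      have e : f = P * g := funext hfg
      rw [e, analyticOrderAt_mul (hP.analyticAt _) (hg.analyticAt _),
        (hP.analyticAt _).analyticOrderAt_eq_zero.2 hPσ, zero_add] at hord
      exact hord
    obtain ⟨G, hG, hGσ, hgG⟩ := aux_divide g hg σ hσ0 (k σ) hord'
    have hG0 : G 0 = 1 := by simpa [hg0] using (hgG 0).symm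
    refine ⟨G, hG, hG0, ?_, ?_, ?_⟩
    · intro ρ hρ
      rcases Finset.mem_insert.1 hρ with rfl | h
      · exact hGσ
      · intro h0; apply hgS ρ h; rw [hgG, h0, mul_zero]
    · intro z
      rw [Finset.prod_insert hσ, hfg, hgG]; ring
    · rw [Finset.sum_insert hσ]
      have e : g = fun z => (1 - z / σ) ^ k σ * G z := funext hgG
      rw [e, aux_D_mul _ _ (by fun_prop) hG (by simp) (by simp [hG0]), aux_D_lin _ hσ0] at hD
      linear_combination hD

lemma aux_bound (f : ℂ → ℂ) (k : ℂ → ℕ) (R E : ℝ) (hR : 0 < R)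
    (hE : ∀ z, ‖z‖ ≤ 3 * R → ‖f z‖ ≤ E)
    (S : Finset ℂ) (hS : ∀ ρ ∈ S, ρ ≠ 0 ∧ ‖ρ‖ ≤ R)
    (g : ℂ → ℂ) (hg : Differentiable ℂ g)
    (hfg : ∀ z, f z = (∏ ρ ∈ S, (1 - z / ρ) ^ k ρ) * g z) (z : ℂ) (hz : ‖z‖ ≤ 3 * R) :
    2 ^ (∑ ρ ∈ S, k ρ) * ‖g z‖ ≤ E := by
  have h2 : (0 : ℝ) < 2 ^ (∑ ρ ∈ S, k ρ) := by positivity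
  rw [mul_comm, ← le_div_iff₀ h2]
  have h3 : (3 * R) ≠ 0 := by positivity
  refine Complex.norm_le_of_forall_mem_frontier_norm_le (U := Metric.ball 0 (3 * R))
    Metric.isBounded_ball hg.diffContOnCl ?_ ?_
  · intro w hw
    rw [frontier_ball _ h3, mem_sphere_zero_iff_norm] at hw
    rw [le_div_iff₀ h2]
    refine le_trans ?_ (hE w hw.le)
    rw [hfg, norm_mul, mul_comm, norm_prod, ← Finset.prod_pow_eq_pow_sum]
    refine mul_le_mul_of_nonneg_right ?_ (norm_nonneg _)
    refine Finset.prod_le_prod (fun _ _ => by positivity) fun ρ hρ => ?_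
    rw [norm_pow]
    refine pow_le_pow_left₀ (by norm_num) ?_ _
    have hρp : 0 < ‖ρ‖ := norm_pos_iff.2 (hS ρ hρ).1
    have : 3 ≤ ‖w / ρ‖ := by
      rw [norm_div, hw, le_div_iff₀ hρp]
      linarith [(hS ρ hρ).2]
    have t := norm_sub_norm_le (w / ρ) 1
    rw [norm_one, norm_sub_rev] at t
    linarith
  · rw [closure_ball _ h3]; simpa using hz

lemma aux_log (g : ℂ → ℂ) (hg : Differentiable ℂ g) (hg0 : g 0 = 1) (R M : ℝ) (hR : 0 < R)
    (hM : 0 < M) (hz : ∀ z, ‖z‖ < R → g z ≠ 0) (hb : ∀ z, ‖z‖ < R → ‖g z‖ ≤ Real.exp M) :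
    ‖deriv (logDeriv g) 0‖ ≤ 16 * M / R ^ 2 := by
  have hd : DifferentiableOn ℂ (logDeriv g) (Metric.ball 0 R) := by
    intro z hzR
    exact ((hg.analyticAt z).deriv.differentiableAt.div (hg z)
      (hz z (by simpa using hzR))).differentiableWithinAt
  obtain ⟨l, hl0, hl⟩ := hd.isExactOn_ball.with_val_at 0 0
  have hexp : ∀ z ∈ Metric.ball (0 : ℂ) R, g z = Complex.exp (l z) := by
    intro z hzR
    have hder : ∀ w ∈ Metric.ball (0 : ℂ) R, HasDerivAt (fun w => g w * Complex.exp (-l w)) 0 w := by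
      intro w hw
      have h := (hg w).hasDerivAt.mul ((hl w hw).neg.cexp)
      refine h.congr_deriv ?_
      rw [logDeriv_apply]
      have := hz w (by simpa using hw)
      simp only [Pi.neg_apply]
      field_simp
      ring
    have := (convex_ball (0:ℂ) R).is_const_of_fderivWithin_eq_zero (𝕜 := ℂ)
      (f := fun w => g w * Complex.exp (-l w))
      (fun w hw => (hder w hw).differentiableAt.differentiableWithinAt)
      (fun w hw => by
        rw [fderivWithin_of_isOpen Metric.isOpen_ball hw]
        ext; simp [(hder w hw).deriv]) hzR (Metric.mem_ball_self hR)
    simp only [hg0, hl0, neg_zero, Complex.exp_zero, mul_one] at this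
    rw [Complex.exp_neg] at this
    field_simp [Complex.exp_ne_zero] at this
    exact this
  have hld : DifferentiableOn ℂ l (Metric.ball 0 R) :=
    fun z h => (hl z h).differentiableAt.differentiableWithinAt
  have hre : Set.MapsTo l (Metric.ball 0 R) {z | z.re ≤ M} := by
    intro z h
    have := hb z (by simpa using h)
    rw [hexp z h, Complex.norm_exp] at this
    exact Real.exp_le_exp.1 this
  have hbound : ∀ z ∈ Metric.sphere (0 : ℂ) (R / 2), ‖l z‖ ≤ 2 * M := by
    intro z h
    rw [mem_sphere_zero_iff_norm] at h
    have := Complex.borelCaratheodory_zero hM hld hre hR (z := z) (by simp [h]; linarith) hl0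
    rw [h] at this
    refine this.trans (le_of_eq ?_)
    field_simp
    ring
  have hC := Complex.norm_iteratedDeriv_le_of_forall_mem_sphere_norm_le (f := l) 2 (half_pos hR)
    ((hld.mono (by
      rw [closure_ball _ (half_pos hR).ne']
      exact Metric.closedBall_subset_ball (half_lt_self hR))).diffContOnCl) hbound
  have e : iteratedDeriv 2 l 0 = deriv (logDeriv g) 0 := by
    rw [iteratedDeriv_succ, iteratedDeriv_one]
    refine Filter.EventuallyEq.deriv_eq ?_
    filter_upwards [Metric.ball_mem_nhds (0:ℂ) hR] with z hz
    exact (hl z hz).deriv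
  rw [e] at hC
  refine hC.trans (le_of_eq ?_)
  simp [Nat.factorial]
  field_simp
  ring

lemma aux_main (f : ℂ → ℂ) (hf : Differentiable ℂ f) (hf0 : f 0 = 1) (C : ℝ) (hC : 0 < C)
    (hgr : ∀ R : ℝ, 1 ≤ R → ∀ z, ‖z‖ ≤ R → ‖f z‖ ≤ Real.exp (C * R ^ (3 / 2 : ℝ)))
    (Z : Set ℂ) (hZ : ∀ z, z ∈ Z ↔ f z = 0)
    (k : ℂ → ℕ) (hk : ∀ ρ ∈ Z, analyticOrderAt f ρ = (k ρ : ℕ∞)) :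
    HasSum (fun ρ : Z => (k ρ : ℂ) / (ρ : ℂ) ^ 2) (- deriv (logDeriv f) 0) := by
  classical
  have hZ0 : ∀ ρ ∈ Z, ρ ≠ 0 := by
    rintro ρ hρ rfl
    rw [hZ, hf0] at hρ
    exact one_ne_zero hρ
  have hk1 : ∀ ρ ∈ Z, 1 ≤ k ρ := by
    intro ρ hρ
    rw [Nat.one_le_iff_ne_zero]
    intro h0
    have := hk ρ hρ
    rw [h0, Nat.cast_zero, (hf.analyticAt ρ).analyticOrderAt_eq_zero] at this
    exact this ((hZ ρ).1 hρ)
  -- counting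
  have hcount : ∀ R : ℝ, 1 ≤ R → ∀ S : Finset ℂ, (∀ ρ ∈ S, ρ ∈ Z ∧ ‖ρ‖ ≤ R) →
      (∑ ρ ∈ S, (k ρ : ℝ)) ≤ 2 * (C * (3 * R) ^ (3 / 2 : ℝ)) := by
    intro R hR S hS
    obtain ⟨g, hg, hg0, -, hfg, -⟩ := aux_factor f hf hf0 k S
      (fun ρ h => ⟨hZ0 ρ (hS ρ h).1, hk ρ (hS ρ h).1⟩)
    have hb := aux_bound f k R _ (by linarith) (hgr (3 * R) (by linarith)) S
      (fun ρ h => ⟨hZ0 ρ (hS ρ h).1, (hS ρ h).2⟩) g hg hfg 0 (by simp; linarith)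
    rw [hg0, norm_one, mul_one] at hb
    have hlog := Real.log_le_log (by positivity) hb
    rw [Real.log_pow, Real.log_exp] at hlog
    push_cast at hlog
    have hs : (0 : ℝ) ≤ ∑ ρ ∈ S, (k ρ : ℝ) := Finset.sum_nonneg fun _ _ => by positivity
    have hl2 := Real.log_two_gt_d9
    nlinarith
  -- separation from 0
  obtain ⟨δ, hδ, hδ1, hδZ⟩ : ∃ δ : ℝ, 0 < δ ∧ δ ≤ 1 ∧ ∀ ρ ∈ Z, δ ≤ ‖ρ‖ := by
    have := hf.continuous.continuousAt.eventually_ne (by rw [hf0]; exact one_ne_zero : f 0 ≠ 0)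
    obtain ⟨ε, hε, h⟩ := Metric.eventually_nhds_iff.1 this
    refine ⟨min ε 1, by positivity, min_le_right _ _, fun ρ hρ => ?_⟩
    by_contra hlt
    push Not at hlt
    exact h (y := ρ) (by simpa using hlt.trans_le (min_le_left _ _)) ((hZ ρ).1 hρ)
  -- summability
  let b : ℕ → ℝ := fun j => ((δ ^ 2)⁻¹ * (1 / 4) ^ j)
  let q : ℝ := 2 ^ (3 / 2 : ℝ) / 4
  have hq0 : 0 ≤ q := by positivity
  have hq1 : q < 1 := by
    rw [div_lt_one (by norm_num)]
    calc (2 : ℝ) ^ (3 / 2 : ℝ) < 2 ^ (2 : ℝ) := Real.rpow_lt_rpow_of_exponent_lt (by norm_num) (by norm_num)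
      _ = 4 := by norm_num
  let A : ℝ := (δ ^ 2)⁻¹ * (2 * (C * (6 : ℝ) ^ (3 / 2 : ℝ)))
  have hA : 0 ≤ A := by positivity
  have hsumA : Summable fun j : ℕ => A * q ^ j := (summable_geometric_of_lt_one hq0 hq1).mul_left A
  have hjex : ∀ ρ ∈ Z, ∃ j : ℕ, ‖ρ‖ ≤ 2 ^ (j + 1) ∧ (‖ρ‖ ^ 2)⁻¹ ≤ b j := by
    intro ρ hρ
    have h1 : 1 ≤ ‖ρ‖ / δ := by rw [one_le_div hδ]; exact hδZ ρ hρ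
    obtain ⟨j, hj1, hj2⟩ := exists_nat_pow_near h1 (by norm_num : (1:ℝ) < 2)
    refine ⟨j, ?_, ?_⟩
    · rw [div_lt_iff₀ hδ] at hj2
      have : (0:ℝ) < 2 ^ (j + 1) := by positivity
      nlinarith
    · rw [le_div_iff₀ hδ] at hj1
      have e : b j = ((2 ^ j * δ) ^ 2)⁻¹ := by
        simp only [b]
        rw [mul_pow, mul_inv, mul_comm, ← pow_mul, mul_comm j 2, pow_mul, one_div, inv_pow]
        norm_num
      rw [e]
      gcongr
  choose! J hJ1 hJ2 using hjex
  have hsum : Summable fun ρ : Z => (k ρ : ℝ) * (‖(ρ : ℂ)‖ ^ 2)⁻¹ := by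
    refine summable_of_sum_le (c := ∑' j, A * q ^ j) (fun ρ => by positivity) fun u => ?_
    let S : Finset ℂ := u.image Subtype.val
    have hSZ : ∀ ρ ∈ S, ρ ∈ Z := by
      intro ρ h
      obtain ⟨x, -, rfl⟩ := Finset.mem_image.1 h
      exact x.2
    have e1 : ∑ ρ ∈ u, (k ρ : ℝ) * (‖(ρ : ℂ)‖ ^ 2)⁻¹ = ∑ ρ ∈ S, (k ρ : ℝ) * (‖ρ‖ ^ 2)⁻¹ := by
      rw [Finset.sum_image (fun x _ y _ h => Subtype.ext h)]
    rw [e1]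
    have e2 : ∑ ρ ∈ S, (k ρ : ℝ) * (‖ρ‖ ^ 2)⁻¹ ≤ ∑ ρ ∈ S, (k ρ : ℝ) * b (J ρ) :=
      Finset.sum_le_sum fun ρ h => mul_le_mul_of_nonneg_left (hJ2 ρ (hSZ ρ h)) (by positivity)
    refine e2.trans ?_
    rw [← Finset.sum_fiberwise_of_maps_to (t := S.image J)
      (fun ρ h => Finset.mem_image_of_mem J h)]
    refine le_trans ?_ (hsumA.sum_le_tsum (S.image J) (fun j _ => by positivity))
    refine Finset.sum_le_sum fun j _ => ?_
    have e3 : ∑ ρ ∈ S with J ρ = j, (k ρ : ℝ) * b (J ρ) = b j * ∑ ρ ∈ S with J ρ = j, (k ρ : ℝ) := by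
      rw [Finset.mul_sum]
      refine Finset.sum_congr rfl fun ρ h => ?_
      rw [(Finset.mem_filter.1 h).2, mul_comm]
    rw [e3]
    have h4 := hcount (2 ^ (j + 1)) (one_le_pow₀ (by norm_num)) {ρ ∈ S | J ρ = j} (by
      intro ρ h
      obtain ⟨h1, h2⟩ := Finset.mem_filter.1 h
      exact ⟨hSZ ρ h1, h2 ▸ hJ1 ρ (hSZ ρ h1)⟩)
    refine (mul_le_mul_of_nonneg_left h4 (by positivity)).trans (le_of_eq ?_)
    have e5 : (3 * 2 ^ (j + 1) : ℝ) ^ (3 / 2 : ℝ) = 6 ^ (3 / 2 : ℝ) * (2 ^ (3 / 2 : ℝ)) ^ j := by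
      rw [pow_succ, show (3 * (2 ^ j * 2) : ℝ) = 6 * 2 ^ j by ring,
        Real.mul_rpow (by norm_num) (by positivity), ← Real.rpow_natCast, ← Real.rpow_natCast,
        ← Real.rpow_mul (by norm_num), ← Real.rpow_mul (by norm_num), mul_comm (j : ℝ)]
    rw [e5]
    simp only [b, A, q]
    rw [div_pow, div_pow, one_pow]
    ring
  have hsumC : Summable fun ρ : Z => (k ρ : ℂ) / (ρ : ℂ) ^ 2 := by
    refine Summable.of_norm (hsum.congr fun ρ => ?_)
    rw [norm_div, norm_pow, Complex.norm_natCast, div_eq_mul_inv]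
  -- finiteness
  have hfin : ∀ R : ℝ, 0 < R → {ρ : Z | ‖(ρ : ℂ)‖ ≤ R}.Finite := by
    intro R hR
    have h1 := hsum.tendsto_cofinite_zero.eventually_lt_const
      (show (0 : ℝ) < (R ^ 2)⁻¹ by positivity)
    refine (Filter.eventually_cofinite.1 h1).subset fun ρ hρ => ?_
    simp only [Set.mem_ofPred_eq, not_lt] at hρ ⊢
    have hp : 0 < ‖(ρ : ℂ)‖ := norm_pos_iff.2 (hZ0 ρ ρ.2)
    have h2 : (R ^ 2)⁻¹ ≤ (‖(ρ : ℂ)‖ ^ 2)⁻¹ := by gcongr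
    have h3 : (1 : ℝ) ≤ k ρ := by exact_mod_cast hk1 ρ ρ.2
    have h4 : 0 ≤ (‖(ρ : ℂ)‖ ^ 2)⁻¹ := by positivity
    nlinarith
  let T : ℕ → Finset Z := fun N => (hfin ((N : ℝ) + 1) (by positivity)).toFinset
  have hT : Filter.Tendsto T Filter.atTop Filter.atTop := by
    refine Filter.tendsto_atTop_finset_of_monotone ?_ ?_
    · intro m n hmn ρ
      simp only [T, Set.Finite.mem_toFinset, Set.mem_ofPred_eq]
      intro h
      have : (m : ℝ) ≤ n := by exact_mod_cast hmn
      linarith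
    · intro ρ
      obtain ⟨n, hn⟩ := exists_nat_ge ‖(ρ : ℂ)‖
      refine ⟨n, ?_⟩
      simp only [T, Set.Finite.mem_toFinset, Set.mem_ofPred_eq]
      linarith
  have hlim : Filter.Tendsto (fun N => ∑ ρ ∈ T N, (k ρ : ℂ) / (ρ : ℂ) ^ 2) Filter.atTop
      (nhds (- deriv (logDeriv f) 0)) := by
    have hest : ∀ N : ℕ, ‖(∑ ρ ∈ T N, (k ρ : ℂ) / (ρ : ℂ) ^ 2) - (- deriv (logDeriv f) 0)‖ ≤
        (16 * (C * 3 ^ (3 / 2 : ℝ))) * ((N : ℝ) + 1) ^ (-(1 / 2) : ℝ) := by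
      intro N
      set R : ℝ := (N : ℝ) + 1 with hRdef
      have hR1 : 1 ≤ R := by simp [hRdef]
      have hR : 0 < R := by linarith
      let S : Finset ℂ := (T N).image Subtype.val
      have hSmem : ∀ ρ, ρ ∈ S ↔ ρ ∈ Z ∧ ‖ρ‖ ≤ R := by
        intro ρ
        simp [S, T, hRdef]
        tauto
      obtain ⟨g, hg, hg0, hgS, hfg, hD⟩ := aux_factor f hf hf0 k S
        (fun ρ h => ⟨hZ0 ρ ((hSmem ρ).1 h).1, hk ρ ((hSmem ρ).1 h).1⟩)
      have hb := aux_bound f k R _ hR (hgr (3 * R) (by linarith)) S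
        (fun ρ h => ⟨hZ0 ρ ((hSmem ρ).1 h).1, ((hSmem ρ).1 h).2⟩) g hg hfg
      have hl := aux_log g hg hg0 R (C * (3 * R) ^ (3 / 2 : ℝ)) hR (by positivity) ?_ ?_
      · rw [hD] at hl
        have e : ∑ ρ ∈ T N, (k ρ : ℂ) / (ρ : ℂ) ^ 2 = ∑ ρ ∈ S, (k ρ : ℂ) / ρ ^ 2 := by
          rw [Finset.sum_image (fun x _ y _ h => Subtype.ext h)]
        rw [e, sub_neg_eq_add, add_comm]
        refine hl.trans (le_of_eq ?_)
        rw [Real.mul_rpow (by norm_num) hR.le, show (-(1 / 2) : ℝ) = 3 / 2 - 2 by norm_num,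
          Real.rpow_sub hR, Real.rpow_two]
        ring
      · intro z hz h0
        have hzZ : z ∈ Z := by rw [hZ, hfg, h0, mul_zero]
        exact hgS z ((hSmem z).2 ⟨hzZ, hz.le⟩) h0
      · intro z hz
        refine le_trans ?_ (hb z (by linarith))
        have : (1 : ℝ) ≤ 2 ^ (∑ ρ ∈ S, k ρ) := one_le_pow₀ (by norm_num)
        nlinarith [norm_nonneg (g z)]
    rw [tendsto_iff_norm_sub_tendsto_zero]
    refine squeeze_zero (fun _ => norm_nonneg _) hest ?_
    rw [← mul_zero (16 * (C * 3 ^ (3 / 2 : ℝ)))]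
    refine Filter.Tendsto.const_mul _ ?_
    exact (tendsto_rpow_neg_atTop (by norm_num : (0:ℝ) < 1 / 2)).comp
      (Filter.tendsto_atTop_add_const_right _ _ tendsto_natCast_atTop_atTop)
  have := tendsto_nhds_unique (hsumC.hasSum.comp hT) hlim
  rw [← this]
  exact hsumC.hasSum

lemma aux_factor_bound (w : ℂ) : ‖1 + w‖ ≤ Real.exp (w.re + 2 * ‖w‖ ^ (3 / 2 : ℝ)) := by
  have hn := norm_nonneg w
  rcases le_total ‖w‖ 1 with h | h
  · have h1 : ‖1 + w‖ ^ 2 ≤ Real.exp (w.re + ‖w‖ ^ 2 / 2) ^ 2 := by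
      rw [← Real.exp_nat_mul]
      refine le_trans (le_of_eq ?_) (Real.add_one_le_exp _)
      rw [Complex.sq_norm, Complex.sq_norm, Complex.normSq_apply, Complex.normSq_apply]
      simp
      ring
    refine (le_of_sq_le_sq h1 (Real.exp_nonneg _)).trans (Real.exp_le_exp.2 ?_)
    have : ‖w‖ ^ 2 ≤ ‖w‖ ^ (3 / 2 : ℝ) := by
      rcases hn.eq_or_lt with h0 | h0
      · rw [← h0]; norm_num
      · rw [← Real.rpow_two]
        exact Real.rpow_le_rpow_of_exponent_ge h0 h (by norm_num)
    nlinarith [sq_nonneg ‖w‖]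
  · have h1 : ‖1 + w‖ ≤ 1 + ‖w‖ := (norm_add_le _ _).trans (by simp)
    have h2 : 1 + ‖w‖ ≤ Real.exp ‖w‖ := by linarith [Real.add_one_le_exp ‖w‖]
    refine (h1.trans h2).trans (Real.exp_le_exp.2 ?_)
    have h3 : ‖w‖ ≤ ‖w‖ ^ (3 / 2 : ℝ) := Real.self_le_rpow_of_one_le h (by norm_num)
    have h4 := (abs_le.1 (Complex.abs_re_le_norm w)).1
    linarith

lemma aux_growth : ∃ C : ℝ, 0 < C ∧ ∀ z : ℂ,
    ‖(Complex.Gamma z)⁻¹‖ ≤ ‖z‖ * Real.exp (C * ‖z‖ + C * ‖z‖ ^ (3 / 2 : ℝ)) := by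
  have hs : Summable fun j : ℕ => ((j : ℝ) + 1) ^ (-(3 / 2) : ℝ) := by
    have := (summable_nat_add_iff 1).2
      (Real.summable_nat_rpow.2 (by norm_num : (-(3 / 2) : ℝ) < -1))
    simpa using this
  set B : ℝ := ∑' j : ℕ, ((j : ℝ) + 1) ^ (-(3 / 2) : ℝ) with hB
  have hB0 : 0 ≤ B := tsum_nonneg fun j => by positivity
  set K : ℝ := |Real.eulerMascheroniConstant| + 1 with hK
  have hK0 : 0 < K := by positivity
  refine ⟨2 * B + K, by positivity, fun z => ?_⟩
  have hgoal : ‖z‖ * Real.exp (K * ‖z‖ + 2 * B * ‖z‖ ^ (3 / 2 : ℝ)) ≤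
      ‖z‖ * Real.exp ((2 * B + K) * ‖z‖ + (2 * B + K) * ‖z‖ ^ (3 / 2 : ℝ)) := by
    gcongr <;> linarith
  refine le_trans ?_ hgoal
  by_cases h0 : Complex.Gamma z = 0
  · rw [h0]; simp; positivity
  have ht := ((Complex.GammaSeq_tendsto_Gamma z).inv₀ h0).norm
  refine le_of_tendsto ht ?_
  have hab := (Real.tendsto_harmonic_sub_log.abs).eventually_lt_const
    (show |Real.eulerMascheroniConstant| < K by simp [hK])
  filter_upwards [hab, Filter.eventually_gt_atTop 0] with n hn hn0
  have hnR : (0 : ℝ) < n := by exact_mod_cast hn0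
  have hfac : ((n.factorial : ℕ) : ℂ) = ∏ j ∈ Finset.range n, ((j : ℂ) + 1) := by
    rw [← Finset.prod_range_add_one_eq_factorial]; push_cast; rfl
  have e : (Complex.GammaSeq z n)⁻¹ =
      z * (∏ j ∈ Finset.range n, (1 + z / ((j : ℂ) + 1))) * ((n : ℂ) ^ z)⁻¹ := by
    have hj : ∀ j : ℕ, ((j : ℂ) + 1) ≠ 0 := fun j => by exact_mod_cast Nat.succ_ne_zero j
    rw [Complex.GammaSeq, Finset.prod_range_succ', hfac]
    have : ∏ j ∈ Finset.range n, (1 + z / ((j : ℂ) + 1)) =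
        (∏ j ∈ Finset.range n, (z + ((j + 1 : ℕ) : ℂ))) / ∏ j ∈ Finset.range n, ((j : ℂ) + 1) := by
      rw [← Finset.prod_div_distrib]
      refine Finset.prod_congr rfl fun j _ => ?_
      have := hj j
      push_cast
      field_simp
      ring
    rw [this, inv_div]
    simp only [Nat.cast_zero, add_zero]
    rw [div_eq_mul_inv, mul_inv, div_eq_mul_inv]
    ring
  rw [e, norm_mul, norm_mul, mul_assoc]
  refine mul_le_mul_of_nonneg_left ?_ (norm_nonneg z)
  have hcp : ‖((n : ℂ) ^ z)⁻¹‖ = Real.exp (-(Real.log n * z.re)) := by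
    rw [norm_inv, Complex.norm_natCast_cpow_of_pos hn0, Real.rpow_def_of_pos hnR, Real.exp_neg]
  rw [hcp, norm_prod]
  have hprod : ∏ j ∈ Finset.range n, ‖1 + z / ((j : ℂ) + 1)‖ ≤
      Real.exp (∑ j ∈ Finset.range n,
        (z.re * ((j : ℝ) + 1)⁻¹ + 2 * (‖z‖ ^ (3 / 2 : ℝ) * ((j : ℝ) + 1) ^ (-(3 / 2) : ℝ)))) := by
    rw [Real.exp_sum]
    refine Finset.prod_le_prod (fun _ _ => norm_nonneg _) fun j _ => ?_
    refine (aux_factor_bound _).trans (le_of_eq ?_)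
    have hj : (0 : ℝ) < (j : ℝ) + 1 := by positivity
    have e1 : z / ((j : ℂ) + 1) = z / (((j : ℝ) + 1 : ℝ) : ℂ) := by push_cast; rfl
    rw [e1, Complex.div_ofReal_re, norm_div, Complex.norm_real, Real.norm_of_nonneg hj.le,
      Real.div_rpow (norm_nonneg _) hj.le, Real.rpow_neg hj.le, div_eq_mul_inv, div_eq_mul_inv]
  refine (mul_le_mul_of_nonneg_right hprod (Real.exp_nonneg _)).trans ?_
  rw [← Real.exp_add]
  refine Real.exp_le_exp.2 ?_
  have hH : ((harmonic n : ℚ) : ℝ) = ∑ j ∈ Finset.range n, ((j : ℝ) + 1)⁻¹ := by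
    simp [harmonic]
  rw [Finset.sum_add_distrib, ← Finset.mul_sum, ← Finset.mul_sum, ← Finset.mul_sum, ← hH]
  have h1 : ∑ j ∈ Finset.range n, ((j : ℝ) + 1) ^ (-(3 / 2) : ℝ) ≤ B :=
    hs.sum_le_tsum _ fun j _ => by positivity
  have h2 : z.re * ((harmonic n : ℝ) - Real.log n) ≤ ‖z‖ * K := by
    refine (le_abs_self _).trans ?_
    rw [abs_mul]
    exact mul_le_mul (Complex.abs_re_le_norm z) hn.le (abs_nonneg _) (norm_nonneg _)
  have h3 := mul_le_mul_of_nonneg_left h1 (show 0 ≤ ‖z‖ ^ (3 / 2 : ℝ) by positivity)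
  linarith

lemma aux_deriv (a : ℂ) :
    deriv (logDeriv (fun z => 1 - a * (Complex.Gamma z)⁻¹)) 0 =
      - (2 * a * (Real.eulerMascheroniConstant : ℂ) + a ^ 2) := by
  set u : ℂ → ℂ := fun z => (Complex.Gamma (z + 1))⁻¹ with hu
  have hud : Differentiable ℂ u :=
    Complex.differentiable_one_div_Gamma.comp (differentiable_id.add_const 1)
  have hu0 : u 0 = 1 := by simp [hu]
  have hu' : HasDerivAt u (Real.eulerMascheroniConstant : ℂ) 0 := by
    have h1 : HasDerivAt Complex.Gamma (-(Real.eulerMascheroniConstant : ℂ)) ((0 : ℂ) + 1) := by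
      rw [zero_add]; exact Complex.hasDerivAt_Gamma_one
    have h2 := (h1.comp_add_const (0 : ℂ) 1).inv (by simp)
    exact h2.congr_deriv (by simp)
  have hf : (fun z => 1 - a * (Complex.Gamma z)⁻¹) = fun z => 1 - a * (z * u z) := by
    funext z; rw [Complex.one_div_Gamma_eq_self_mul_one_div_Gamma_add_one]
  have hd : ∀ z, HasDerivAt (fun z => 1 - a * (z * u z)) (-(a * (1 * u z + z * deriv u z))) z :=
    fun z => (((hasDerivAt_id z).mul (hud z).hasDerivAt).const_mul a).const_sub 1
  have hl : logDeriv (fun z => 1 - a * (z * u z)) =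
      fun z => (-(a * (1 * u z + z * deriv u z))) / (1 - a * (z * u z)) := by
    funext z; rw [logDeriv_apply, (hd z).deriv]
  rw [hf, hl]
  have hdd : DifferentiableAt ℂ (deriv u) 0 := (hud.analyticAt 0).deriv.differentiableAt
  have h := (((hu'.const_mul 1).add ((hasDerivAt_id (0 : ℂ)).mul hdd.hasDerivAt)).const_mul a).neg.div
    (hd 0) (by simp)
  refine (HasDerivAt.deriv h).trans ?_
  simp [hu0, hu'.deriv]
  ring

/-- For nonzero complex `a`, the solutions `ρ` of `Γ(ρ) = a`, counted with their
multiplicities `k_ρ` as zeros of `Γ(·) - a`, satisfy `∑_ρ k_ρ/ρ² = 2aγ + a²`. -/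
theorem sum_inv_sq_solutions_Gamma_eq (a : ℂ) (ha : a ≠ 0) (k : ℂ → ℕ)
    (hk : ∀ ρ : ℂ, Complex.Gamma ρ = a →
      ∃ h : AnalyticAt ℂ (fun z => Complex.Gamma z - a) ρ,
        analyticOrderAt (fun z => Complex.Gamma z - a) ρ = (k ρ : ℕ∞)) :
    Summable (fun ρ : {ρ : ℂ // Complex.Gamma ρ = a} => (k ρ : ℂ) / (ρ : ℂ) ^ 2) ∧
    ∑' ρ : {ρ : ℂ // Complex.Gamma ρ = a}, (k ρ : ℂ) / (ρ : ℂ) ^ 2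
      = 2 * a * (Real.eulerMascheroniConstant : ℂ) + a ^ 2 := by
  obtain ⟨C, hC, hgr⟩ := aux_growth
  have hinv := Complex.differentiable_one_div_Gamma
  have hf : Differentiable ℂ (fun z => 1 - a * (Complex.Gamma z)⁻¹) :=
    (hinv.const_mul a).const_sub 1
  have main := aux_main (fun z => 1 - a * (Complex.Gamma z)⁻¹) hf (by simp)
    (2 * C + 1 + ‖a‖) (by positivity) ?_ {ρ : ℂ | Complex.Gamma ρ = a} ?_ k ?_
  · rw [aux_deriv, neg_neg] at main
    exact ⟨main.summable, main.tsum_eq⟩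
  · intro R hR z hz
    have hRp : R ≤ R ^ (3 / 2 : ℝ) := Real.self_le_rpow_of_one_le hR (by norm_num)
    have hzp : ‖z‖ ^ (3 / 2 : ℝ) ≤ R ^ (3 / 2 : ℝ) :=
      Real.rpow_le_rpow (norm_nonneg _) hz (by norm_num)
    set X := R ^ (3 / 2 : ℝ) with hX
    have hX1 : 1 ≤ X := hR.trans hRp
    have h1 : ‖(Complex.Gamma z)⁻¹‖ ≤ Real.exp ((2 * C + 1) * X) := by
      refine (hgr z).trans ?_
      have : ‖z‖ ≤ Real.exp ‖z‖ := by linarith [Real.add_one_le_exp ‖z‖]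
      refine (mul_le_mul_of_nonneg_right this (Real.exp_nonneg _)).trans ?_
      rw [← Real.exp_add]
      refine Real.exp_le_exp.2 ?_
      nlinarith
    have h2 : 1 ≤ Real.exp ((2 * C + 1) * X) := Real.one_le_exp (by positivity)
    calc ‖1 - a * (Complex.Gamma z)⁻¹‖ ≤ 1 + ‖a‖ * ‖(Complex.Gamma z)⁻¹‖ := by
          refine (norm_sub_le _ _).trans ?_
          rw [norm_one, norm_mul]
      _ ≤ (‖a‖ + 1) * Real.exp ((2 * C + 1) * X) := by
          nlinarith [mul_le_mul_of_nonneg_left h1 (norm_nonneg a)]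
      _ ≤ Real.exp ‖a‖ * Real.exp ((2 * C + 1) * X) := by
          gcongr; exact Real.add_one_le_exp _
      _ ≤ Real.exp ((2 * C + 1 + ‖a‖) * X) := by
          rw [← Real.exp_add]
          refine Real.exp_le_exp.2 ?_
          nlinarith [norm_nonneg a]
  · intro z
    change Complex.Gamma z = a ↔ 1 - a * (Complex.Gamma z)⁻¹ = 0
    constructor
    · intro h; rw [h, mul_inv_cancel₀ ha, sub_self]
    · intro h
      have h0 : Complex.Gamma z ≠ 0 := by
        intro h0; rw [h0] at h; simp at h
      field_simp at h
      exact sub_eq_zero.1 (by simpa using h)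
  · intro ρ hρ
    have hρ' : Complex.Gamma ρ = a := hρ
    obtain ⟨h, ho⟩ := hk ρ hρ'
    have hA : AnalyticAt ℂ (fun z => (Complex.Gamma z)⁻¹) ρ := hinv.analyticAt ρ
    have hcont : ContinuousAt Complex.Gamma ρ := by
      have := h.continuousAt.add_const a
      simpa using this
    have hev : (fun z => 1 - a * (Complex.Gamma z)⁻¹) =ᶠ[nhds ρ]
        ((fun z => Complex.Gamma z - a) * fun z => (Complex.Gamma z)⁻¹) := by
      filter_upwards [hcont.eventually_ne (by rw [hρ']; exact ha : Complex.Gamma ρ ≠ 0)] with z hz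
      simp only [Pi.mul_apply]
      rw [sub_mul, mul_inv_cancel₀ hz]
    rw [analyticOrderAt_congr hev, analyticOrderAt_mul h hA, ho,
      hA.analyticOrderAt_eq_zero.2 (by rw [hρ']; exact inv_ne_zero ha), add_zero]
end

section
/- Let γ be the Euler–Mascheroni constant and let Z = {ρ ∈ ℂ : Γ(ρ) = −2γ}. For ρ ∈ Z let k_ρ denote the order of ρ as a zero of z ↦ Γ(z) + 2γ. Then ∑_{ρ∈Z} k_ρ/ρ² = 0 (the series converging absolutely). -/
open Complex Real

lemma extract_zeros (F : ℂ → ℂ) (hF : Differentiable ℂ F) (k : ℂ → ℕ) (S : Finset ℂ)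
    (hS : ∀ ρ ∈ S, analyticOrderAt F ρ = (k ρ : ℕ∞)) :
    ∃ G : ℂ → ℂ, Differentiable ℂ G ∧ (∀ z, F z = (∏ ρ ∈ S, (z - ρ) ^ k ρ) * G z) ∧
      ∀ ρ ∈ S, G ρ ≠ 0 := by
  classical
  induction S using Finset.induction_on with
  | empty => exact ⟨F, hF, by simp, by simp⟩
  | insert a S ha ih =>
    obtain ⟨G, hG, hGF, hG0⟩ := ih (fun ρ hρ => hS ρ (Finset.mem_insert_of_mem hρ))
    have hPd : Differentiable ℂ (fun z : ℂ => ∏ ρ ∈ S, (z - ρ) ^ k ρ) := by fun_prop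
    have hPa : (fun z : ℂ => ∏ ρ ∈ S, (z - ρ) ^ k ρ) a ≠ 0 := by
      refine Finset.prod_ne_zero_iff.2 fun ρ hρ => pow_ne_zero _ (sub_ne_zero.2 ?_)
      rintro rfl; exact ha hρ
    have hord : analyticOrderAt G a = (k a : ℕ∞) := by
      have h1 : F = (fun z : ℂ => ∏ ρ ∈ S, (z - ρ) ^ k ρ) * G := funext hGF
      have h2 := hS a (Finset.mem_insert_self _ _)
      rw [h1, analyticOrderAt_mul (hPd.analyticAt a) (hG.analyticAt a),
        (hPd.analyticAt a).analyticOrderAt_eq_zero.2 hPa, zero_add] at h2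
      exact h2
    obtain ⟨g, hg, hga, hgG⟩ := (hG.analyticAt a).analyticOrderAt_eq_natCast.1 hord
    let H : ℂ → ℂ := Function.update (fun z => G z / (z - a) ^ k a) a (g a)
    have hHne : ∀ z, z ≠ a → H z = G z / (z - a) ^ k a := fun z hz => by
      simp [H, Function.update_of_ne hz]
    have hHa : H a = g a := by simp [H]
    have hHg : H =ᶠ[nhds a] g := by
      filter_upwards [hgG] with z hz
      by_cases h : z = a
      · rw [h, hHa]
      · rw [hHne z h, hz, smul_eq_mul, mul_div_cancel_left₀]
        exact pow_ne_zero _ (sub_ne_zero.2 h)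
    have hGH : ∀ z, G z = (z - a) ^ k a * H z := by
      intro z
      by_cases h : z = a
      · rw [h, hHa]; simpa using hgG.self_of_nhds
      · rw [hHne z h, mul_div_cancel₀]
        exact pow_ne_zero _ (sub_ne_zero.2 h)
    refine ⟨H, ?_, ?_, ?_⟩
    · intro z
      by_cases h : z = a
      · subst h; exact hg.differentiableAt.congr_of_eventuallyEq hHg
      · have : H =ᶠ[nhds z] fun z => G z / (z - a) ^ k a := by
          filter_upwards [isOpen_ne.mem_nhds h] with w hw using hHne w hw
        refine DifferentiableAt.congr_of_eventuallyEq ?_ this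
        exact (hG z).div (by fun_prop) (pow_ne_zero _ (sub_ne_zero.2 h))
    · intro z
      rw [Finset.prod_insert ha, hGF, hGH]; ring
    · intro ρ hρ
      rcases Finset.mem_insert.1 hρ with rfl | h
      · rwa [hHa]
      · have := hG0 ρ h
        rw [hGH] at this
        exact right_ne_zero_of_mul this

/-- second-derivative bound for the logarithm of a zero-free function -/
lemma logDeriv_bound (g : ℂ → ℂ) (R M : ℝ) (hR : 0 < R) (hg : Differentiable ℂ g)
    (h0 : ∀ z ∈ Metric.ball (0:ℂ) R, g z ≠ 0) (hM : 0 < M)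
    (hgM : ∀ z ∈ Metric.ball (0:ℂ) R, ‖g z‖ ≤ Real.exp M) (hg1 : 1 ≤ ‖g 0‖) :
    ‖deriv (logDeriv g) 0‖ ≤ 16 * M / R ^ 2 := by
  have hmem : (0:ℂ) ∈ Metric.ball (0:ℂ) R := by simpa using hR
  have hgd : Differentiable ℂ (deriv g) := by
    intro z
    exact (hg.analyticAt z).deriv.differentiableAt
  have hL : DifferentiableOn ℂ (logDeriv g) (Metric.ball 0 R) := by
    intro z hz
    exact ((hgd z).div (hg z) (h0 z hz)).differentiableWithinAt
  obtain ⟨h, hh0, hh⟩ := hL.isExactOn_ball.with_val_at 0 0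
  have hhd : DifferentiableOn ℂ h (Metric.ball 0 R) := fun z hz =>
    (hh z hz).differentiableAt.differentiableWithinAt
  have hder : ∀ z ∈ Metric.ball (0:ℂ) R, HasDerivAt (fun z => g z * cexp (-h z)) 0 z := by
    intro z hz
    have := (hg z).hasDerivAt.mul ((hh z hz).neg.cexp)
    refine this.congr_deriv ?_
    rw [logDeriv_apply]
    have := h0 z hz
    simp only [Pi.neg_apply]
    field_simp
    ring
  have hconst : ∀ z ∈ Metric.ball (0:ℂ) R, g z * cexp (-h z) = g 0 := by
    intro z hz
    have := Metric.isOpen_ball.is_const_of_deriv_eq_zero (f := fun z => g z * cexp (-h z))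
      (convex_ball (0:ℂ) R).isPreconnected
      (fun z hz => (hder z hz).differentiableAt.differentiableWithinAt)
      (fun z hz => (hder z hz).deriv) hz hmem
    simpa [hh0] using this
  have hre : Set.MapsTo h (Metric.ball 0 R) {z | z.re ≤ M} := by
    intro z hz
    have h1 : g z = g 0 * cexp (h z) := by
      rw [← hconst z hz, mul_assoc, ← Complex.exp_add]; simp
    have h2 := hgM z hz
    rw [h1, norm_mul, Complex.norm_exp] at h2
    have h3 : Real.exp (h z).re ≤ Real.exp M := by
      refine le_trans ?_ h2
      exact le_mul_of_one_le_left (Real.exp_pos _).le hg1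
    exact Real.exp_le_exp.1 h3
  have hb : ∀ z ∈ Metric.sphere (0:ℂ) (R/2), ‖h z‖ ≤ 2 * M := by
    intro z hz
    have hz' : ‖z‖ = R / 2 := by simpa using hz
    have := borelCaratheodory_zero hM hhd hre hR (z := z) (by simp [hz']; linarith) hh0
    rw [hz'] at this
    refine this.trans (le_of_eq ?_)
    field_simp
    ring
  have hcl : DiffContOnCl ℂ h (Metric.ball 0 (R/2)) := by
    apply DifferentiableOn.diffContOnCl
    refine hhd.mono ?_
    refine Metric.closure_ball_subset_closedBall.trans (Metric.closedBall_subset_ball (by linarith))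
  have hc := norm_iteratedDeriv_le_of_forall_mem_sphere_norm_le 2 (by positivity) hcl hb
  have he : iteratedDeriv 2 h 0 = deriv (logDeriv g) 0 := by
    rw [iteratedDeriv_succ, iteratedDeriv_one]
    apply Filter.EventuallyEq.deriv_eq
    filter_upwards [Metric.isOpen_ball.mem_nhds hmem] with z hz using (hh z hz).deriv
  rw [he] at hc
  refine hc.trans (le_of_eq ?_)
  simp [Nat.factorial]
  field_simp
  ring

/-- The Blaschke-modified function. -/
lemma blaschke (F : ℂ → ℂ) (hF : Differentiable ℂ F) (hF0 : F 0 = 1) (k : ℂ → ℕ) (S : Finset ℂ)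
    (R M : ℝ) (hR : 0 < R) (hM : 0 < M)
    (hS : ∀ ρ ∈ S, analyticOrderAt F ρ = (k ρ : ℕ∞))
    (hSR : ∀ ρ ∈ S, ‖ρ‖ < R) (hS0 : ∀ ρ ∈ S, ρ ≠ 0)
    (hFM : ∀ z, ‖z‖ ≤ R → ‖F z‖ ≤ Real.exp M) :
    (∑ ρ ∈ S, k ρ * Real.log (R / ‖ρ‖) ≤ M) ∧
    ((∀ z, ‖z‖ < R → F z = 0 → z ∈ S) →
      ‖deriv (logDeriv F) 0 + ∑ ρ ∈ S, (k ρ : ℂ) * (1 / ρ ^ 2 - (starRingEnd ℂ ρ) ^ 2 / R ^ 4)‖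
        ≤ 16 * M / R ^ 2) := by
  obtain ⟨G, hG, hFG, hG0⟩ := extract_zeros F hF k S hS
  have hRC : (R : ℂ) ≠ 0 := by exact_mod_cast hR.ne'
  let B : ℂ → ℂ := fun z => ∏ ρ ∈ S, ((R ^ 2 - starRingEnd ℂ ρ * z) / R) ^ k ρ
  have hB : Differentiable ℂ B := by
    intro z
    simp only [B]
    fun_prop
  let g : ℂ → ℂ := fun z => B z * G z
  have hg : Differentiable ℂ g := hB.mul hG
  have hB0 : ∀ z, ‖z‖ ≤ R → ∀ ρ ∈ S, (R:ℂ) ^ 2 - starRingEnd ℂ ρ * z ≠ 0 := by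
    intro z hz ρ hρ h
    have h1 : ‖(R:ℂ) ^ 2‖ = ‖starRingEnd ℂ ρ * z‖ := by rw [sub_eq_zero.1 h]
    rw [norm_mul, norm_pow, Complex.norm_real, RCLike.norm_conj, Real.norm_of_nonneg hR.le] at h1
    have := hSR ρ hρ
    nlinarith [norm_nonneg ρ, norm_nonneg z]
  -- relation of factors on the circle
  have hcirc : ∀ z, ‖z‖ = R → ‖g z‖ = ‖F z‖ := by
    intro z hz
    rw [hFG]
    simp only [g, B, norm_mul, norm_prod, norm_pow]
    congr 1
    refine Finset.prod_congr rfl fun ρ hρ => ?_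
    congr 1
    have h1 : (R : ℂ) ^ 2 - starRingEnd ℂ ρ * z = starRingEnd ℂ (z - ρ) * z := by
      rw [map_sub, sub_mul, ← Complex.normSq_eq_conj_mul_self, Complex.normSq_eq_norm_sq, hz]
      push_cast; ring
    rw [h1, norm_div, norm_mul, RCLike.norm_conj, hz, Complex.norm_real,
      Real.norm_of_nonneg hR.le, mul_div_cancel_right₀ _ hR.ne']
  have hgM : ∀ z ∈ Metric.closedBall (0:ℂ) R, ‖g z‖ ≤ Real.exp M := by
    intro z hz
    refine norm_le_of_forall_mem_frontier_norm_le (U := Metric.ball 0 R) Metric.isBounded_ball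
      hg.diffContOnCl ?_ (by rwa [closure_ball _ hR.ne'])
    intro w hw
    rw [frontier_ball _ hR.ne'] at hw
    have hw' : ‖w‖ = R := by simpa using hw
    rw [hcirc w hw']
    exact hFM w hw'.le
  have hg0 : ‖g 0‖ = ∏ ρ ∈ S, (R / ‖ρ‖) ^ k ρ := by
    have h1 : ‖F 0‖ = 1 := by simp [hF0]
    rw [hFG, norm_mul, norm_prod] at h1
    simp only [g, B, norm_mul, norm_prod]
    have hne : (∏ ρ ∈ S, ‖(0 - ρ) ^ k ρ‖) ≠ 0 := left_ne_zero_of_mul (h1 ▸ one_ne_zero)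
    have h2 : ‖G 0‖ = (∏ ρ ∈ S, ‖(0 - ρ) ^ k ρ‖)⁻¹ := eq_inv_of_mul_eq_one_right h1
    rw [h2, ← div_eq_mul_inv, ← Finset.prod_div_distrib]
    refine Finset.prod_congr rfl fun ρ hρ => ?_
    rw [norm_pow, norm_pow, ← div_pow]
    congr 1
    simp only [mul_zero, sub_zero, zero_sub, norm_neg, norm_div, norm_pow, Complex.norm_real,
      Real.norm_of_nonneg hR.le]
    congr 1
    field_simp
  have hrat : ∀ ρ ∈ S, 1 ≤ R / ‖ρ‖ := fun ρ hρ => by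
    rw [le_div_iff₀ (norm_pos_iff.2 (hS0 ρ hρ)), one_mul]; exact (hSR ρ hρ).le
  have hg1 : 1 ≤ ‖g 0‖ := by
    rw [hg0]
    calc (1:ℝ) = ∏ ρ ∈ S, 1 := by simp
      _ ≤ _ := Finset.prod_le_prod (by simp) fun ρ hρ => one_le_pow₀ (hrat ρ hρ)
  refine ⟨?_, ?_⟩
  · have h1 := hgM 0 (by simp [hR.le])
    have h2 : Real.log ‖g 0‖ ≤ M := (Real.log_le_iff_le_exp (by linarith)).2 h1
    rw [hg0, Real.log_prod] at h2
    · simpa [Real.log_pow] using h2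
    · intro ρ hρ
      have := hrat ρ hρ
      positivity
  · intro hSall
    have hgne : ∀ z ∈ Metric.ball (0:ℂ) R, g z ≠ 0 := by
      intro z hz
      have hz' : ‖z‖ < R := by simpa using hz
      refine mul_ne_zero ?_ ?_
      · exact Finset.prod_ne_zero_iff.2 fun ρ hρ => pow_ne_zero _
          (div_ne_zero (hB0 z hz'.le ρ hρ) hRC)
      · intro h
        have : F z = 0 := by rw [hFG, h, mul_zero]
        exact hG0 z (hSall z hz' this) h
    have hbd := logDeriv_bound g R M hR hg hgne hM
      (fun z hz => hgM z (Metric.ball_subset_closedBall hz)) hg1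
    have hev : logDeriv F =ᶠ[nhds 0] fun z => logDeriv g z +
        ∑ ρ ∈ S, (k ρ : ℂ) * (1 / (z - ρ) + starRingEnd ℂ ρ / (R ^ 2 - starRingEnd ℂ ρ * z)) := by
      have hn1 : ∀ᶠ z in nhds (0:ℂ), F z ≠ 0 :=
        hF.continuous.continuousAt.eventually_ne (by simp [hF0])
      filter_upwards [hn1, Metric.ball_mem_nhds (0:ℂ) hR] with z hz1 hz2
      have hz' : ‖z‖ < R := by simpa using hz2
      have hFG' : F = fun z => (∏ ρ ∈ S, (z - ρ) ^ k ρ) * G z := funext hFG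
      have hzS : ∀ ρ ∈ S, (z - ρ) ^ k ρ ≠ 0 := by
        have := hFG z ▸ hz1
        exact Finset.prod_ne_zero_iff.1 (left_ne_zero_of_mul this)
      have hk0 : ∀ ρ ∈ S, k ρ ≠ 0 → z - ρ ≠ 0 := by
        intro ρ hρ hk h
        exact hzS ρ hρ (by rw [h, zero_pow hk])
      have hGz : G z ≠ 0 := right_ne_zero_of_mul (hFG z ▸ hz1)
      have e1 : logDeriv F z = (∑ ρ ∈ S, (k ρ : ℂ) * (1 / (z - ρ))) + logDeriv G z := by
        rw [hFG', logDeriv_mul z (Finset.prod_ne_zero_iff.2 hzS) hGz (by fun_prop) (hG z),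
          logDeriv_prod hzS (fun ρ hρ => by fun_prop)]
        congr 1
        refine Finset.sum_congr rfl fun ρ hρ => ?_
        rw [logDeriv_fun_pow (by fun_prop), logDeriv_apply]
        simp
      have hBf : ∀ ρ ∈ S, (((R:ℂ) ^ 2 - starRingEnd ℂ ρ * z) / R) ^ k ρ ≠ 0 := fun ρ hρ =>
        pow_ne_zero _ (div_ne_zero (hB0 z hz'.le ρ hρ) hRC)
      have e2 : logDeriv g z = (∑ ρ ∈ S, (k ρ : ℂ) *
          (-starRingEnd ℂ ρ / (R ^ 2 - starRingEnd ℂ ρ * z))) + logDeriv G z := by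
        rw [logDeriv_mul z (Finset.prod_ne_zero_iff.2 hBf) hGz (hB z) (hG z),
          logDeriv_prod hBf (fun ρ hρ => by fun_prop)]
        congr 1
        refine Finset.sum_congr rfl fun ρ hρ => ?_
        rw [logDeriv_fun_pow (by fun_prop), logDeriv_apply]
        congr 1
        have hd : HasDerivAt (fun w : ℂ => ((R:ℂ) ^ 2 - starRingEnd ℂ ρ * w) / R)
            ((-(starRingEnd ℂ ρ * 1)) / R) z :=
          (((hasDerivAt_id z).const_mul _).const_sub _).div_const _
        rw [hd.deriv]
        have := hB0 z hz'.le ρ hρ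
        field_simp
      rw [e1, e2]
      simp only [mul_add, Finset.sum_add_distrib, neg_div, mul_neg, Finset.sum_neg_distrib]
      ring
    have hgd : DifferentiableAt ℂ (logDeriv g) 0 :=
      ((hg.analyticAt 0).deriv.differentiableAt).div (hg 0) (hgne 0 (by simpa using hR))
    have hsum : HasDerivAt (fun z : ℂ => ∑ ρ ∈ S, (k ρ : ℂ) *
        (1 / (z - ρ) + starRingEnd ℂ ρ / (R ^ 2 - starRingEnd ℂ ρ * z)))
        (∑ ρ ∈ S, (k ρ : ℂ) * (-(1 / ρ ^ 2) + (starRingEnd ℂ ρ) ^ 2 / R ^ 4)) 0 := by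
      refine HasDerivAt.fun_sum fun ρ hρ => ?_
      refine HasDerivAt.const_mul _ ?_
      have hρ0 := hS0 ρ hρ
      refine HasDerivAt.add ?_ ?_
      · have := (hasDerivAt_const (0:ℂ) (1:ℂ)).div ((hasDerivAt_id (0:ℂ)).sub_const ρ)
          (by simpa using hρ0)
        refine this.congr_deriv ?_
        simp
        ring
      · have := (hasDerivAt_const (0:ℂ) (starRingEnd ℂ ρ)).div
          (((hasDerivAt_id (0:ℂ)).const_mul (starRingEnd ℂ ρ)).const_sub ((R:ℂ) ^ 2))
          (by simpa using hRC)
        refine this.congr_deriv ?_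
        simp
        field_simp
    have hfin : deriv (logDeriv F) 0 = deriv (logDeriv g) 0 +
        ∑ ρ ∈ S, (k ρ : ℂ) * (-(1 / ρ ^ 2) + (starRingEnd ℂ ρ) ^ 2 / R ^ 4) := by
      rw [hev.deriv_eq]
      exact (hgd.hasDerivAt.add hsum).deriv
    have : deriv (logDeriv F) 0 +
        ∑ ρ ∈ S, (k ρ : ℂ) * (1 / ρ ^ 2 - (starRingEnd ℂ ρ) ^ 2 / R ^ 4)
        = deriv (logDeriv g) 0 := by
      rw [hfin, add_assoc, ← Finset.sum_add_distrib, Finset.sum_eq_zero, add_zero]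
      intro ρ hρ; ring
    rw [this]; exact hbd

lemma four_pow_sqrt (m : ℕ) : (4:ℝ) ^ m * √((4:ℝ) ^ m) = 8 ^ m := by
  have : (4:ℝ) ^ m = (2 ^ m) ^ 2 := by rw [← pow_mul, mul_comm, pow_mul]; norm_num
  have h2 : √((4:ℝ) ^ m) = 2 ^ m := by rw [this, Real.sqrt_sq (by positivity)]
  rw [h2, ← mul_pow]; norm_num

lemma count_bound (F : ℂ → ℂ) (hF : Differentiable ℂ F) (hF0 : F 0 = 1) (k : ℂ → ℕ)
    (hk : ∀ ρ, F ρ = 0 → analyticOrderAt F ρ = (k ρ : ℕ∞)) (C : ℝ) (hC : 0 < C)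
    (hgr : ∀ R : ℝ, 1 ≤ R → ∀ z : ℂ, ‖z‖ ≤ R → ‖F z‖ ≤ Real.exp (C * (R * √R)))
    (m : ℕ) (T : Finset ℂ) (hT : ∀ ρ ∈ T, F ρ = 0) (hTm : ∀ ρ ∈ T, ‖ρ‖ ≤ 4 ^ m) :
    ∑ ρ ∈ T, (k ρ : ℝ) ≤ 8 * C * 8 ^ m := by
  have h0 : ∀ ρ ∈ T, ρ ≠ 0 := by
    rintro ρ hρ rfl
    have := hT 0 hρ
    rw [hF0] at this
    exact one_ne_zero this
  have hlt : (4:ℝ) ^ m < 4 ^ (m + 1) := pow_lt_pow_right₀ (by norm_num) (by omega)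
  have h := (blaschke F hF hF0 k T (4 ^ (m+1)) (C * 8 ^ (m+1)) (by positivity) (by positivity)
    (fun ρ hρ => hk ρ (hT ρ hρ)) (fun ρ hρ => (hTm ρ hρ).trans_lt hlt) h0
    (fun z hz => by
      have := hgr (4 ^ (m+1)) (one_le_pow₀ (by norm_num)) z hz
      rwa [four_pow_sqrt] at this)).1
  have hle : ∑ ρ ∈ T, (k ρ : ℝ) ≤ ∑ ρ ∈ T, k ρ * Real.log (4 ^ (m+1) / ‖ρ‖) := by
    refine Finset.sum_le_sum fun ρ hρ => ?_
    refine le_mul_of_one_le_right (Nat.cast_nonneg _) ?_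
    have hp := norm_pos_iff.2 (h0 ρ hρ)
    rw [Real.le_log_iff_exp_le (by positivity)]
    have h3 : Real.exp 1 ≤ 4 := by have := Real.exp_one_lt_d9; linarith
    refine h3.trans ?_
    rw [le_div_iff₀ hp, pow_succ]
    nlinarith [hTm ρ hρ]
  refine hle.trans (h.trans (le_of_eq ?_))
  rw [pow_succ]; ring

lemma finite_zeros (F : ℂ → ℂ) (hF : Differentiable ℂ F) (hF0 : F 0 = 1) (r : ℝ) :
    {z : ℂ | ‖z‖ ≤ r ∧ F z = 0}.Finite := by
  have h1 : AnalyticOnNhd ℂ F Set.univ := fun z _ => hF.analyticAt z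
  by_contra hinf
  have hsub : {z : ℂ | ‖z‖ ≤ r ∧ F z = 0} ⊆ Metric.closedBall 0 r := fun z hz => by
    simpa using hz.1
  obtain ⟨x, hx, hacc⟩ := Set.Infinite.exists_accPt_of_subset_isCompact hinf
    (isCompact_closedBall 0 r) hsub
  have hfr : ∃ᶠ z in nhdsWithin x {x}ᶜ, F z = 0 :=
    (accPt_iff_frequently_nhdsNE.1 hacc).mono fun z hz => hz.2
  have := h1.eqOn_zero_of_preconnected_of_frequently_eq_zero isPreconnected_univ
    (Set.mem_univ x) hfr (Set.mem_univ 0)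
  rw [hF0] at this
  exact one_ne_zero this

theorem sum_thm (F : ℂ → ℂ) (hF : Differentiable ℂ F) (hF0 : F 0 = 1) (k : ℂ → ℕ)
    (hk : ∀ ρ, F ρ = 0 → analyticOrderAt F ρ = (k ρ : ℕ∞)) (C : ℝ) (hC : 0 < C)
    (hgr : ∀ R : ℝ, 1 ≤ R → ∀ z : ℂ, ‖z‖ ≤ R → ‖F z‖ ≤ Real.exp (C * (R * √R)))
    (P : ℂ → Prop) (hP : ∀ ρ, P ρ ↔ F ρ = 0) :
    Summable (fun ρ : {ρ : ℂ // P ρ} => (k ρ : ℂ) / (ρ : ℂ) ^ 2) ∧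
    ∑' ρ : {ρ : ℂ // P ρ}, (k ρ : ℂ) / (ρ : ℂ) ^ 2 = - deriv (logDeriv F) 0 := by
  classical
  have hcount := count_bound F hF hF0 k hk C hC hgr
  obtain ⟨δ, hδ, hδF⟩ : ∃ δ > 0, ∀ ρ, F ρ = 0 → δ ≤ ‖ρ‖ := by
    have : ∀ᶠ z in nhds (0:ℂ), F z ≠ 0 :=
      hF.continuous.continuousAt.eventually_ne (by simp [hF0])
    obtain ⟨δ, hδ, h⟩ := Metric.eventually_nhds_iff_ball.1 this
    refine ⟨δ, hδ, fun ρ hρ => ?_⟩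
    by_contra hlt
    exact h ρ (by simpa using hlt) hρ
  have hex : ∀ ρ : ℂ, ∃ j : ℕ, ‖ρ‖ ≤ 4 ^ j := fun ρ =>
    (pow_unbounded_of_one_lt ‖ρ‖ (by norm_num : (1:ℝ) < 4)).imp fun _ h => h.le
  let J : ℂ → ℕ := fun ρ => Nat.find (hex ρ)
  have hJ1 : ∀ ρ, ‖ρ‖ ≤ 4 ^ J ρ := fun ρ => Nat.find_spec (hex ρ)
  let A : ℝ := 16 + 1 / δ ^ 2
  have hA : 0 < A := by positivity
  have hJ2 : ∀ ρ, F ρ = 0 → 1 / ‖ρ‖ ^ 2 ≤ A * (1 / 16) ^ J ρ := by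
    intro ρ hρ
    have hd := hδF ρ hρ
    have hp : 0 < ‖ρ‖ := hδ.trans_le hd
    rcases Nat.eq_zero_or_pos (J ρ) with h0 | h0
    · rw [h0, pow_zero, mul_one]
      have : 1 / ‖ρ‖ ^ 2 ≤ 1 / δ ^ 2 := by gcongr
      simp only [A]; linarith
    · have hlt : 4 ^ (J ρ - 1) < ‖ρ‖ := by
        have := Nat.find_min (hex ρ) (show J ρ - 1 < Nat.find (hex ρ) from by
          change J ρ - 1 < J ρ; omega)
        exact not_le.1 this
      have h4 : (4:ℝ) ^ J ρ < 4 * ‖ρ‖ := by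
        have : (4:ℝ) ^ J ρ = 4 * 4 ^ (J ρ - 1) := by
          rw [← pow_succ']; congr 1; omega
        rw [this]; linarith
      have h16 : (16:ℝ) ^ J ρ ≤ 16 * ‖ρ‖ ^ 2 := by
        have e : (16:ℝ) ^ J ρ = (4 ^ J ρ) ^ 2 := by rw [← pow_mul, mul_comm, pow_mul]; norm_num
        rw [e]
        have : (0:ℝ) < 4 ^ J ρ := by positivity
        nlinarith
      calc 1 / ‖ρ‖ ^ 2 = 16 * (1 / (16 * ‖ρ‖ ^ 2)) := by field_simp
        _ ≤ 16 * (1 / 16 ^ J ρ) := by gcongr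
        _ ≤ A * (1 / 16) ^ J ρ := by
          rw [one_div_pow]
          have : 16 ≤ A := by simp only [A]; linarith [show 0 < 1 / δ ^ 2 by positivity]
          gcongr
  have hbound : ∀ T : Finset ℂ, (∀ ρ ∈ T, F ρ = 0) →
      ∑ ρ ∈ T, (k ρ : ℝ) / ‖ρ‖ ^ 2 ≤ A * (8 * C) * 2 := by
    intro T hT
    obtain ⟨N, hN⟩ : ∃ N, ∀ ρ ∈ T, J ρ ∈ Finset.range N :=
      ⟨T.sup J + 1, fun ρ hρ => Finset.mem_range.2 (Nat.lt_succ_of_le (Finset.le_sup hρ))⟩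
    calc ∑ ρ ∈ T, (k ρ : ℝ) / ‖ρ‖ ^ 2 ≤ ∑ ρ ∈ T, (k ρ : ℝ) * (A * (1 / 16) ^ J ρ) := by
          refine Finset.sum_le_sum fun ρ hρ => ?_
          rw [div_eq_mul_one_div]
          exact mul_le_mul_of_nonneg_left (hJ2 ρ (hT ρ hρ)) (Nat.cast_nonneg _)
      _ = ∑ j ∈ Finset.range N, ∑ ρ ∈ T with J ρ = j, (k ρ : ℝ) * (A * (1 / 16) ^ J ρ) :=
          (Finset.sum_fiberwise_of_maps_to hN _).symm
      _ ≤ ∑ j ∈ Finset.range N, (A * (8 * C)) * (1 / 2) ^ j := by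
          refine Finset.sum_le_sum fun j _ => ?_
          have e : ∑ ρ ∈ T with J ρ = j, (k ρ : ℝ) * (A * (1 / 16) ^ J ρ)
              = (∑ ρ ∈ T with J ρ = j, (k ρ : ℝ)) * (A * (1 / 16) ^ j) := by
            rw [Finset.sum_mul]
            refine Finset.sum_congr rfl fun ρ hρ => ?_
            rw [(Finset.mem_filter.1 hρ).2]
          rw [e]
          have hc := hcount j (T.filter (fun ρ => J ρ = j))
            (fun ρ hρ => hT ρ (Finset.mem_filter.1 hρ).1)
            (fun ρ hρ => (Finset.mem_filter.1 hρ).2 ▸ hJ1 ρ)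
          refine (mul_le_mul_of_nonneg_right hc (by positivity)).trans (le_of_eq ?_)
          have : (1 / 2 : ℝ) ^ j = 8 ^ j * (1 / 16) ^ j := by rw [← mul_pow]; norm_num
          rw [this]; ring
      _ ≤ A * (8 * C) * 2 := by
          rw [← Finset.mul_sum]
          refine mul_le_mul_of_nonneg_left ?_ (by positivity)
          exact sum_geometric_two_le N
  have hsumm : Summable (fun ρ : {ρ : ℂ // P ρ} => (k ρ : ℂ) / (ρ : ℂ) ^ 2) := by
    refine Summable.of_norm (summable_of_sum_le (c := A * (8 * C) * 2)
      (fun _ => norm_nonneg _) fun T => ?_)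
    have := hbound (T.map (Function.Embedding.subtype P)) (by
      intro ρ hρ
      obtain ⟨x, _, rfl⟩ := Finset.mem_map.1 hρ
      exact (hP _).1 x.2)
    rw [Finset.sum_map] at this
    simpa using this
  refine ⟨hsumm, ?_⟩
  -- zeros in the disk of radius 4^m
  have hfin : ∀ m : ℕ, {ρ : {ρ : ℂ // P ρ} | ‖(ρ:ℂ)‖ < 4 ^ m}.Finite := by
    intro m
    refine Set.Finite.of_finite_image (f := Subtype.val) ?_ Subtype.val_injective.injOn
    refine (finite_zeros F hF hF0 (4 ^ m)).subset ?_
    rintro _ ⟨x, hx, rfl⟩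
    exact ⟨le_of_lt hx, (hP _).1 x.2⟩
  let S : ℕ → Finset {ρ : ℂ // P ρ} := fun m => (hfin m).toFinset
  have hSmem : ∀ m x, x ∈ S m ↔ ‖(x:ℂ)‖ < 4 ^ m := fun m x => by simp [S]
  have hStend : Filter.Tendsto S Filter.atTop Filter.atTop := by
    refine Filter.tendsto_atTop_finset_of_monotone ?_ ?_
    · intro m n hmn x hx
      rw [hSmem] at hx ⊢
      exact hx.trans_le (pow_le_pow_right₀ (by norm_num) hmn)
    · intro x
      obtain ⟨m, hm⟩ := pow_unbounded_of_one_lt ‖(x:ℂ)‖ (by norm_num : (1:ℝ) < 4)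
      exact ⟨m, (hSmem m x).2 hm⟩
  have ht1 : Filter.Tendsto (fun m => ∑ x ∈ S m, (k x : ℂ) / (x : ℂ) ^ 2) Filter.atTop
      (nhds (∑' ρ : {ρ : ℂ // P ρ}, (k ρ : ℂ) / (ρ : ℂ) ^ 2)) := hsumm.hasSum.comp hStend
  have ht2 : Filter.Tendsto (fun m => ∑ x ∈ S m, (k x : ℂ) / (x : ℂ) ^ 2) Filter.atTop
      (nhds (- deriv (logDeriv F) 0)) := by
    rw [tendsto_iff_norm_sub_tendsto_zero]
    refine squeeze_zero (g := fun m : ℕ => 24 * C * (1 / 2 : ℝ) ^ m) (fun _ => norm_nonneg _) ?_ ?_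
    · intro m
      have hR : (0:ℝ) < 4 ^ m := by positivity
      let T := (S m).map (Function.Embedding.subtype P)
      have hTz : ∀ ρ ∈ T, F ρ = 0 ∧ ‖ρ‖ < 4 ^ m := by
        intro ρ hρ
        obtain ⟨x, hx, rfl⟩ := Finset.mem_map.1 hρ
        exact ⟨(hP _).1 x.2, (hSmem m x).1 hx⟩
      have hb := (blaschke F hF hF0 k T (4 ^ m) (C * 8 ^ m) hR (by positivity)
        (fun ρ hρ => hk ρ (hTz ρ hρ).1) (fun ρ hρ => (hTz ρ hρ).2)
        (fun ρ hρ => norm_pos_iff.1 (hδ.trans_le (hδF ρ (hTz ρ hρ).1)))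
        (fun z hz => by
          have := hgr (4 ^ m) (one_le_pow₀ (by norm_num)) z hz
          rwa [four_pow_sqrt] at this)).2
        (fun z hz hz0 => Finset.mem_map.2 ⟨⟨z, (hP z).2 hz0⟩, (hSmem _ _).2 hz, rfl⟩)
      have hc := hcount m T (fun ρ hρ => (hTz ρ hρ).1) (fun ρ hρ => (hTz ρ hρ).2.le)
      have e1 : ∑ x ∈ S m, (k x : ℂ) / (x : ℂ) ^ 2 = ∑ ρ ∈ T, (k ρ : ℂ) / ρ ^ 2 := by
        simp [T, Finset.sum_map]
      have e2 : ∑ ρ ∈ T, (k ρ : ℂ) / ρ ^ 2 - -deriv (logDeriv F) 0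
          = (deriv (logDeriv F) 0 + ∑ ρ ∈ T, (k ρ : ℂ) *
            (1 / ρ ^ 2 - (starRingEnd ℂ ρ) ^ 2 / ((4 ^ m : ℝ) : ℂ) ^ 4))
            + ∑ ρ ∈ T, (k ρ : ℂ) * ((starRingEnd ℂ ρ) ^ 2 / ((4 ^ m : ℝ) : ℂ) ^ 4) := by
        rw [add_assoc, ← Finset.sum_add_distrib, sub_neg_eq_add, add_comm]
        congr 1
        refine Finset.sum_congr rfl fun ρ _ => ?_
        ring
      have e3 : ‖∑ ρ ∈ T, (k ρ : ℂ) * ((starRingEnd ℂ ρ) ^ 2 / ((4 ^ m : ℝ) : ℂ) ^ 4)‖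
          ≤ (8 * C * 8 ^ m) * (1 / (4 ^ m) ^ 2) := by
        refine (norm_sum_le _ _).trans ?_
        refine le_trans ?_ (mul_le_mul_of_nonneg_right hc (by positivity))
        rw [Finset.sum_mul]
        refine Finset.sum_le_sum fun ρ hρ => ?_
        rw [norm_mul, norm_div, norm_pow, norm_pow, RCLike.norm_conj, Complex.norm_real,
          Real.norm_of_nonneg hR.le, Complex.norm_natCast]
        refine mul_le_mul_of_nonneg_left ?_ (Nat.cast_nonneg _)
        rw [div_le_div_iff₀ (by positivity) (by positivity), one_mul]
        have h1 := (hTz ρ hρ).2.le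
        calc ‖ρ‖ ^ 2 * (4 ^ m) ^ 2 ≤ (4 ^ m) ^ 2 * (4 ^ m) ^ 2 := by gcongr
          _ = (4 ^ m) ^ 4 := by ring
      rw [e1, e2]
      refine (norm_add_le _ _).trans ((add_le_add hb e3).trans (le_of_eq ?_))
      have h8 : (1 / 2 : ℝ) ^ m = 8 ^ m / (4 ^ m) ^ 2 := by
        rw [← pow_mul, mul_comm m 2, pow_mul, ← div_pow]; norm_num
      rw [h8]; ring
    · have := (tendsto_pow_atTop_nhds_zero_of_lt_one (r := (1/2:ℝ)) (by norm_num)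
        (by norm_num)).const_mul (24 * C)
      simpa using this
  exact tendsto_nhds_unique ht1 ht2

lemma norm_Gamma_le_real (s : ℂ) (hs : 0 < s.re) : ‖Complex.Gamma s‖ ≤ Real.Gamma s.re := by
  rw [Complex.Gamma_eq_integral hs, Real.Gamma_eq_integral hs, Complex.GammaIntegral]
  refine (MeasureTheory.norm_integral_le_integral_norm _).trans (le_of_eq ?_)
  refine MeasureTheory.setIntegral_congr_fun measurableSet_Ioi fun x hx => ?_
  have hx' : (0:ℝ) < x := hx
  simp only [norm_mul, Complex.norm_real, Real.norm_of_nonneg (Real.exp_pos _).le]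
  rw [Complex.norm_cpow_eq_rpow_re_of_pos hx']
  simp

lemma norm_sin_le_exp (z : ℂ) : ‖Complex.sin z‖ ≤ Real.exp ‖z‖ := by
  rw [Complex.sin]
  have h1 : ‖cexp (-z * I)‖ ≤ Real.exp ‖z‖ := by
    simpa using Complex.norm_exp_le_exp_norm (-z * I)
  have h2 : ‖cexp (z * I)‖ ≤ Real.exp ‖z‖ := by
    simpa using Complex.norm_exp_le_exp_norm (z * I)
  have h3 := norm_sub_le (cexp (-z * I)) (cexp (z * I))
  rw [norm_div, norm_mul, Complex.norm_I, mul_one, Complex.norm_ofNat]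
  linarith

lemma strip_bound : ∃ A : ℝ, 0 < A ∧ ∀ w : ℂ, 1 ≤ w.re → w.re ≤ 2 →
    ‖(Complex.Gamma w)⁻¹‖ ≤ A * Real.exp (4 * ‖w‖) := by
  -- real Gamma bounded on [1,2]
  obtain ⟨B, hB⟩ : ∃ B : ℝ, ∀ x ∈ Set.Icc (1:ℝ) 2, ‖Real.Gamma x‖ ≤ B := by
    refine isCompact_Icc.exists_bound_of_continuousOn fun x hx => ?_
    refine (Real.differentiableAt_Gamma fun m h => ?_).continuousAt.continuousWithinAt
    have : (0:ℝ) ≤ m := Nat.cast_nonneg m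
    linarith [hx.1]
  obtain ⟨D, hD⟩ : ∃ D : ℝ, ∀ w ∈ Metric.closedBall (0:ℂ) 3, ‖(Complex.Gamma w)⁻¹‖ ≤ D :=
    (isCompact_closedBall 0 3).exists_bound_of_continuousOn
      Complex.differentiable_one_div_Gamma.continuous.continuousOn
  refine ⟨|B| + |D| + 1, by positivity, fun w h1 h2 => ?_⟩
  by_cases him : |w.im| ≤ 1
  · have hw : w ∈ Metric.closedBall (0:ℂ) 3 := by
      have := Complex.norm_le_abs_re_add_abs_im w
      rw [abs_of_nonneg (by linarith : (0:ℝ) ≤ w.re)] at this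
      simp; linarith
    calc ‖(Complex.Gamma w)⁻¹‖ ≤ D := hD w hw
      _ ≤ |B| + |D| + 1 := by linarith [le_abs_self D, abs_nonneg B]
      _ ≤ _ := le_mul_of_one_le_right (by positivity) (Real.one_le_exp (by positivity))
  · push Not at him
    have hne : ∀ c : ℝ, ∀ m : ℝ, (c:ℂ) - w ≠ m := by
      intro c m h
      have := congrArg Complex.im h
      simp at this
      simp [this] at him
      linarith
    have hn1 : ∀ c : ℝ, 1 ≤ ‖(c:ℂ) - w‖ := by
      intro c
      have := Complex.abs_im_le_norm ((c:ℂ) - w)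
      simp at this
      linarith
    have hG1 : Complex.Gamma (1 - w) ≠ 0 := Complex.Gamma_ne_zero fun m h => by
      have := hne 1 (-m)
      apply this; push_cast; exact h
    have hGw : Complex.Gamma w ≠ 0 := Complex.Gamma_ne_zero_of_re_pos (by linarith)
    have hrefl := Complex.Gamma_mul_Gamma_one_sub w
    have hsin : Complex.sin (π * w) ≠ 0 := by
      intro h
      rw [h, div_zero] at hrefl
      exact mul_ne_zero hGw hG1 hrefl
    have hπ : (π : ℂ) ≠ 0 := by exact_mod_cast Real.pi_ne_zero
    have hw1 : (1:ℂ) - w ≠ 0 := by simpa using hne 1 0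
    have hw2 : (2:ℂ) - w ≠ 0 := by simpa using hne 2 0
    have hG3 : Complex.Gamma (3 - w) = (2 - w) * ((1 - w) * Complex.Gamma (1 - w)) := by
      rw [← Complex.Gamma_add_one _ hw1, show (1:ℂ) - w + 1 = 2 - w by ring,
        ← Complex.Gamma_add_one _ hw2]
      congr 1; ring
    have key : (Complex.Gamma w)⁻¹ =
        Complex.Gamma (3 - w) * Complex.sin (π * w) / (π * ((1 - w) * (2 - w))) := by
      rw [hG3]
      rw [eq_div_iff hsin] at hrefl
      rw [inv_eq_one_div, div_eq_div_iff hGw (mul_ne_zero hπ (mul_ne_zero hw1 hw2))]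
      linear_combination (-((1 - w) * (2 - w))) * hrefl
    rw [key, norm_div, norm_mul]
    have hden : 1 ≤ ‖(π:ℂ) * ((1 - w) * (2 - w))‖ := by
      rw [norm_mul, norm_mul, Complex.norm_real, Real.norm_of_nonneg Real.pi_pos.le]
      have a := hn1 1
      have b := hn1 2
      push_cast at a b
      have hp : (1:ℝ) ≤ π := by linarith [Real.pi_gt_three]
      exact one_le_mul_of_one_le_of_one_le hp (one_le_mul_of_one_le_of_one_le a b)
    refine (div_le_self (by positivity) hden).trans ?_
    have hg : ‖Complex.Gamma (3 - w)‖ ≤ |B| + |D| + 1 := by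
      have hre : (3 - w).re = 3 - w.re := by simp
      have a := norm_Gamma_le_real (3 - w) (by rw [hre]; linarith)
      have b := hB (3 - w).re (by rw [hre]; constructor <;> linarith)
      have c := le_abs_self (Real.Gamma (3 - w).re)
      rw [Real.norm_eq_abs] at b
      linarith [le_abs_self B, abs_nonneg D]
    have hs : ‖Complex.sin (π * w)‖ ≤ Real.exp (4 * ‖w‖) := by
      refine (norm_sin_le_exp _).trans (Real.exp_le_exp.2 ?_)
      rw [norm_mul, Complex.norm_real, Real.norm_of_nonneg Real.pi_pos.le]
      exact mul_le_mul_of_nonneg_right Real.pi_le_four (norm_nonneg _)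
    gcongr

lemma right_shift (w : ℂ) (hw : 1 ≤ w.re) (n : ℕ) :
    ‖(Complex.Gamma (w + n))⁻¹‖ ≤ ‖(Complex.Gamma w)⁻¹‖ := by
  induction n with
  | zero => simp
  | succ n ih =>
    refine le_trans ?_ ih
    rw [Complex.one_div_Gamma_eq_self_mul_one_div_Gamma_add_one (w + n), norm_mul]
    push_cast
    rw [← add_assoc]
    refine le_mul_of_one_le_left (norm_nonneg _) ?_
    have := Complex.re_le_norm (w + n)
    simp at this
    have hn : (0:ℝ) ≤ n := Nat.cast_nonneg n
    linarith

lemma left_shift (z : ℂ) (B : ℝ) (n : ℕ) (hB : ‖z‖ + n ≤ B) :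
    ‖(Complex.Gamma z)⁻¹‖ ≤ B ^ n * ‖(Complex.Gamma (z + n))⁻¹‖ := by
  induction n with
  | zero => simp
  | succ n ih =>
    push_cast at hB
    have hn : (0:ℝ) ≤ n := Nat.cast_nonneg n
    have hB0 : 0 ≤ B := by linarith [norm_nonneg z]
    refine (ih (by linarith)).trans ?_
    rw [Complex.one_div_Gamma_eq_self_mul_one_div_Gamma_add_one (z + n), norm_mul]
    push_cast
    rw [← add_assoc, pow_succ, mul_assoc]
    have h1 : ‖z + n‖ ≤ B := by
      refine (norm_add_le _ _).trans ?_
      rw [Complex.norm_natCast]; linarith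
    gcongr

lemma inv_Gamma_growth : ∃ A : ℝ, 0 < A ∧ ∀ R : ℝ, 1 ≤ R → ∀ z : ℂ, ‖z‖ ≤ R →
    ‖(Complex.Gamma z)⁻¹‖ ≤ A * Real.exp (24 * (R * √R)) := by
  obtain ⟨A, hA, hstrip⟩ := strip_bound
  refine ⟨A, hA, fun R hR z hz => ?_⟩
  have hs1 : 1 ≤ √R := Real.one_le_sqrt.2 hR
  have hRR : R ≤ R * √R := le_mul_of_one_le_right (by linarith) hs1
  have hre := Complex.abs_re_le_norm z
  have him := Complex.abs_im_le_norm z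
  have hwn : ∀ w : ℂ, 1 ≤ w.re → w.re ≤ 2 → w.im = z.im →
      ‖(Complex.Gamma w)⁻¹‖ ≤ A * Real.exp (12 * (R * √R)) := by
    intro w h1 h2 h3
    refine (hstrip w h1 h2).trans ?_
    have : ‖w‖ ≤ 2 + R := by
      have := Complex.norm_le_abs_re_add_abs_im w
      rw [abs_of_nonneg (by linarith : (0:ℝ) ≤ w.re), h3] at this
      linarith
    refine mul_le_mul_of_nonneg_left (Real.exp_le_exp.2 ?_) hA.le
    linarith
  by_cases h1 : 1 ≤ z.re
  · have hfl : 1 ≤ ⌊z.re⌋₊ := Nat.le_floor (by simpa using h1)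
    obtain ⟨n, hn⟩ : ∃ n, ⌊z.re⌋₊ = n + 1 := ⟨⌊z.re⌋₊ - 1, by omega⟩
    have ha : ((n + 1 : ℕ) : ℝ) ≤ z.re := hn ▸ Nat.floor_le (by linarith)
    have hb : z.re < ((n + 1 : ℕ) : ℝ) + 1 := hn ▸ Nat.lt_floor_add_one z.re
    push_cast at ha hb
    have hr := right_shift (z - n) (by simp; linarith) n
    rw [sub_add_cancel] at hr
    refine hr.trans ((hwn (z - n) (by simp; linarith) (by simp; linarith) (by simp)).trans ?_)
    gcongr
    linarith
  · push Not at h1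
    let n := ⌈1 - z.re⌉₊
    have ha : 1 - z.re ≤ n := Nat.le_ceil _
    have hb : (n:ℝ) < 1 - z.re + 1 := Nat.ceil_lt_add_one (by linarith)
    have hnR : (n:ℝ) ≤ 3 * R := by
      have := neg_abs_le z.re
      linarith
    have hl := left_shift z (4 * R) n (by linarith)
    have hw := hwn (z + n) (by simp; linarith) (by simp; linarith) (by simp)
    have hpow : (4 * R) ^ n ≤ Real.exp (12 * (R * √R)) := by
      have hlog : Real.log (4 * R) ≤ 4 * √R := by
        have e : 4 * R = (2 * √R) ^ 2 := by
          rw [mul_pow, Real.sq_sqrt (by linarith)]; norm_num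
        rw [e, Real.log_pow]
        have := Real.log_le_self (show 0 ≤ 2 * √R by positivity)
        push_cast
        linarith
      have hlog0 : 0 ≤ Real.log (4 * R) := Real.log_nonneg (by linarith)
      rw [← Real.exp_log (show 0 < 4 * R by linarith), ← Real.exp_nat_mul]
      refine Real.exp_le_exp.2 ?_
      calc (n:ℝ) * Real.log (4 * R) ≤ (3 * R) * (4 * √R) := by gcongr
        _ = _ := by ring
    calc ‖(Complex.Gamma z)⁻¹‖ ≤ (4 * R) ^ n * ‖(Complex.Gamma (z + n))⁻¹‖ := hl
      _ ≤ Real.exp (12 * (R * √R)) * (A * Real.exp (12 * (R * √R))) := by gcongr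
      _ = A * Real.exp (24 * (R * √R)) := by
        rw [show 24 * (R * √R) = 12 * (R * √R) + 12 * (R * √R) by ring, Real.exp_add]; ring

lemma deriv_logDeriv_zero : deriv (logDeriv (fun z : ℂ =>
    1 + 2 * (Real.eulerMascheroniConstant : ℂ) * (Complex.Gamma z)⁻¹)) 0 = 0 := by
  let c : ℂ := Real.eulerMascheroniConstant
  let E : ℂ → ℂ := fun z => (Complex.Gamma (z + 1))⁻¹
  have hE : Differentiable ℂ E :=
    Complex.differentiable_one_div_Gamma.comp (differentiable_id.add_const 1)
  have hE0 : E 0 = 1 := by simp [E]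
  have hE1 : HasDerivAt E c 0 := by
    have h1 : HasDerivAt Complex.Gamma (-c) (0 + 1) := by
      rw [zero_add]; exact Complex.hasDerivAt_Gamma_one
    have h2 := (h1.comp_add_const 0 1).fun_inv (by simp)
    refine h2.congr_deriv ?_
    simp
  have hEd : Differentiable ℂ (deriv E) := fun z => (hE.analyticAt z).deriv.differentiableAt
  have hFE : (fun z : ℂ => 1 + 2 * (Real.eulerMascheroniConstant : ℂ) * (Complex.Gamma z)⁻¹)
      = fun z => 1 + 2 * c * (z * E z) := by
    funext z
    simp only [E, c]
    rw [Complex.one_div_Gamma_eq_self_mul_one_div_Gamma_add_one z]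
  rw [hFE]
  have hF1 : ∀ z, HasDerivAt (fun z => 1 + 2 * c * (z * E z)) (2 * c * (E z + z * deriv E z)) z := by
    intro z
    have := (((hasDerivAt_id z).mul (hE z).hasDerivAt).const_mul (2 * c)).const_add 1
    refine this.congr_deriv ?_
    simp
  have hld : logDeriv (fun z => 1 + 2 * c * (z * E z)) =
      fun z => (2 * c * (E z + z * deriv E z)) / (1 + 2 * c * (z * E z)) := by
    funext z
    rw [logDeriv_apply, (hF1 z).deriv]
  rw [hld]
  have hN : HasDerivAt (fun z => 2 * c * (E z + z * deriv E z)) (2 * c * (2 * c)) 0 := by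
    have := (hE1.add ((hasDerivAt_id (0:ℂ)).mul (hEd 0).hasDerivAt)).const_mul (2 * c)
    refine this.congr_deriv ?_
    rw [hE1.deriv, id]
    ring
  have := (hN.fun_div (hF1 0) (by simp)).deriv
  rw [this]
  simp [hE0]

/-- The solutions `ρ` of `Γ(ρ) = -2γ`, counted with their multiplicities `k_ρ` as zeros
of `Γ(·) + 2γ`, satisfy `∑_ρ k_ρ/ρ² = 0` (with absolute convergence). -/
theorem sum_inv_sq_solutions_Gamma_eq_neg_two_gamma (k : ℂ → ℕ)
    (hk : ∀ ρ : ℂ, Complex.Gamma ρ = -2 * (Real.eulerMascheroniConstant : ℂ) →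
      ∃ h : AnalyticAt ℂ (fun z => Complex.Gamma z + 2 * (Real.eulerMascheroniConstant : ℂ)) ρ,
        analyticOrderAt (fun z => Complex.Gamma z + 2 * (Real.eulerMascheroniConstant : ℂ)) ρ =
          (k ρ : ℕ∞)) :
    Summable (fun ρ : {ρ : ℂ // Complex.Gamma ρ = -2 * (Real.eulerMascheroniConstant : ℂ)} =>
      (k ρ : ℂ) / (ρ : ℂ) ^ 2) ∧
    ∑' ρ : {ρ : ℂ // Complex.Gamma ρ = -2 * (Real.eulerMascheroniConstant : ℂ)},
      (k ρ : ℂ) / (ρ : ℂ) ^ 2 = 0 := by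
  have hγ : 0 < Real.eulerMascheroniConstant := by
    linarith [Real.one_half_lt_eulerMascheroniConstant]
  have hγC : (Real.eulerMascheroniConstant : ℂ) ≠ 0 := by exact_mod_cast hγ.ne'
  let F : ℂ → ℂ := fun z => 1 + 2 * (Real.eulerMascheroniConstant : ℂ) * (Complex.Gamma z)⁻¹
  have hF : Differentiable ℂ F :=
    (Complex.differentiable_one_div_Gamma.const_mul _).const_add 1
  have hF0 : F 0 = 1 := by simp [F, Complex.Gamma_zero]
  have hP : ∀ ρ, Complex.Gamma ρ = -2 * (Real.eulerMascheroniConstant : ℂ) ↔ F ρ = 0 := by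
    intro ρ
    simp only [F]
    constructor
    · intro h
      rw [h]
      field_simp
      ring
    · intro h
      have hG : Complex.Gamma ρ ≠ 0 := by
        intro h0; simp [h0] at h
      field_simp at h
      linear_combination h
  have hord : ∀ ρ, F ρ = 0 → analyticOrderAt F ρ = (k ρ : ℕ∞) := by
    intro ρ hρ
    have hGρ := (hP ρ).2 hρ
    obtain ⟨han, ho⟩ := hk ρ hGρ
    have hG0 : Complex.Gamma ρ ≠ 0 := by
      rw [hGρ]; simpa using hγC
    have hIan := Complex.differentiable_one_div_Gamma.analyticAt ρ
    have hI0 : (fun s : ℂ => (Complex.Gamma s)⁻¹) ρ ≠ 0 := inv_ne_zero hG0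
    have hev : F =ᶠ[nhds ρ] (fun z => Complex.Gamma z + 2 * (Real.eulerMascheroniConstant : ℂ)) *
        (fun s : ℂ => (Complex.Gamma s)⁻¹) := by
      filter_upwards [hIan.continuousAt.eventually_ne hI0] with z hz
      have hz' : Complex.Gamma z ≠ 0 := fun h => hz (by simp [h])
      simp only [F, Pi.mul_apply]
      field_simp
    rw [analyticOrderAt_congr hev, analyticOrderAt_mul han hIan,
      hIan.analyticOrderAt_eq_zero.2 hI0, add_zero, ho]
  obtain ⟨A, hA, hgr⟩ := inv_Gamma_growth
  let a : ℝ := 2 * Real.eulerMascheroniConstant * A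
  have ha : 0 < a := by positivity
  have hgrowth : ∀ R : ℝ, 1 ≤ R → ∀ z : ℂ, ‖z‖ ≤ R →
      ‖F z‖ ≤ Real.exp ((a + 24) * (R * √R)) := by
    intro R hR z hz
    have hs1 : 1 ≤ √R := Real.one_le_sqrt.2 hR
    have hX : 1 ≤ R * √R := one_le_mul_of_one_le_of_one_le hR hs1
    have h1 : ‖F z‖ ≤ 1 + 2 * Real.eulerMascheroniConstant * ‖(Complex.Gamma z)⁻¹‖ := by
      refine (norm_add_le _ _).trans (le_of_eq ?_)
      rw [norm_mul, norm_mul, Complex.norm_real, Real.norm_of_nonneg hγ.le]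
      simp
    have h2 := hgr R hR z hz
    have hexp1 : 1 ≤ Real.exp (24 * (R * √R)) := Real.one_le_exp (by positivity)
    calc ‖F z‖ ≤ 1 + 2 * Real.eulerMascheroniConstant * (A * Real.exp (24 * (R * √R))) :=
          h1.trans (by gcongr)
      _ = 1 + a * Real.exp (24 * (R * √R)) := by simp only [a]; ring
      _ ≤ (a + 1) * Real.exp (24 * (R * √R)) := by linarith
      _ ≤ Real.exp a * Real.exp (24 * (R * √R)) := by
          gcongr; exact Real.add_one_le_exp a
      _ = Real.exp (a + 24 * (R * √R)) := (Real.exp_add _ _).symm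
      _ ≤ _ := Real.exp_le_exp.2 (by nlinarith)
  have := sum_thm F hF hF0 k hord (a + 24) (by positivity) hgrowth _ hP
  have hz : deriv (logDeriv F) 0 = 0 := deriv_logDeriv_zero
  rwa [hz, neg_zero] at this
end

section
/- Let Z = {ρ ∈ ℂ : e^ρ = 2ρ} be the zero set of the entire function f(z) = e^z − 2z, and for ρ ∈ Z let k_ρ be the order of the zero of f at ρ. Then the series ∑_{ρ∈Z} k_ρ/ρ² converges absolutely and its sum is 0. -/
open Complex

namespace ExpZeros

/-- The entire function under consideration. -/
noncomputable def F (z : ℂ) : ℂ := Complex.exp z - 2 * z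

lemma F_diff : Differentiable ℂ F := by unfold F; fun_prop

lemma F_zero : F 0 = 1 := by simp [F]

lemma F_hasDerivAt (z : ℂ) : HasDerivAt F (Complex.exp z - 2) z := by
  have := (Complex.hasDerivAt_exp z).sub ((hasDerivAt_id z).const_mul 2)
  simpa [F] using! this

lemma F_deriv (z : ℂ) : deriv F z = Complex.exp z - 2 := (F_hasDerivAt z).deriv

lemma zero_ne {ρ : ℂ} (h : F ρ = 0) : ρ ≠ 0 := by
  rintro rfl
  simp [F_zero] at h

lemma simple {ρ : ℂ} (h : F ρ = 0) : deriv F ρ ≠ 0 := by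
  intro h2
  rw [F_deriv] at h2
  have h1 : Complex.exp ρ - 2 * ρ = 0 := h
  have h3 : ρ = 1 := by linear_combination (h2 - h1) / 2
  rw [h3, show (1 : ℂ) = ((1 : ℝ) : ℂ) by simp, ← Complex.ofReal_exp] at h2
  have h4 : Real.exp 1 = 2 := by
    have : ((Real.exp 1 : ℝ) : ℂ) = ((2 : ℝ) : ℂ) := by rw [sub_eq_zero.mp h2]; simp
    exact_mod_cast this
  have := Real.exp_one_gt_d9
  linarith

lemma norm_gt {ρ : ℂ} (h : F ρ = 0) : 1 / 4 < ‖ρ‖ := by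
  by_contra! hc
  have h1 : Complex.exp ρ = 2 * ρ := sub_eq_zero.mp h
  have h2 : Real.exp ρ.re = 2 * ‖ρ‖ := by
    rw [← Complex.norm_exp, h1]; simp
  have h3 := Real.add_one_le_exp ρ.re
  have h4 := Complex.abs_re_le_norm ρ
  have h5 := neg_le_abs ρ.re
  linarith

lemma F_bound {R : ℝ} (hR : 1 ≤ R) {z : ℂ} (hz : ‖z‖ = 4 * R) : ‖F z‖ ≤ Real.exp (6 * R) := by
  have h1 : ‖F z‖ ≤ ‖Complex.exp z‖ + ‖2 * z‖ := norm_sub_le _ _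
  have h2 : ‖Complex.exp z‖ ≤ Real.exp (4 * R) := by
    rw [Complex.norm_exp, ← hz]
    exact Real.exp_le_exp.mpr (Complex.re_le_norm z)
  have h3 : ‖2 * z‖ = 2 * (4 * R) := by rw [norm_mul, hz]; simp
  have h4 := Real.add_one_le_exp (4 * R)
  have h5 : Real.exp (6 * R) = Real.exp (4 * R) * Real.exp (2 * R) := by
    rw [← Real.exp_add]; ring_nf
  have h6 := Real.add_one_le_exp (2 * R)
  have h7 : 0 < Real.exp (4 * R) := Real.exp_pos _
  nlinarith

/-- Dividing out finitely many zeros. -/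
lemma factor (S : Finset ℂ) (hS : ∀ ρ ∈ S, F ρ = 0) :
    ∃ g : ℂ → ℂ, Differentiable ℂ g ∧ ∀ z, F z = (∏ ρ ∈ S, (1 - z / ρ)) * g z := by
  classical
  induction S using Finset.induction_on with
  | empty => exact ⟨F, F_diff, by simp⟩
  | insert a S ha ih =>
    obtain ⟨g, hg, hFg⟩ := ih (fun ρ hρ => hS ρ (Finset.mem_insert_of_mem hρ))
    have hFa := hS a (Finset.mem_insert_self _ _)
    have ha0 := zero_ne hFa
    have hga : g a = 0 := by
      have h := hFg a
      rw [hFa] at h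
      rcases mul_eq_zero.mp h.symm with h | h
      · rw [Finset.prod_eq_zero_iff] at h
        obtain ⟨ρ, hρ, h⟩ := h
        have hρ0 := zero_ne (hS ρ (Finset.mem_insert_of_mem hρ))
        have : a = ρ := by field_simp at h; linear_combination -h
        exact absurd (this ▸ hρ) ha
      · exact h
    refine ⟨fun z => -a * dslope g a z, ?_, ?_⟩
    · have : Differentiable ℂ (dslope g a) := by
        rw [← differentiableOn_univ] at hg ⊢
        exact (Complex.differentiableOn_dslope Filter.univ_mem).mpr hg
      fun_prop
    · intro z
      have h := sub_smul_dslope g a z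
      rw [hga, sub_zero, smul_eq_mul] at h
      rw [hFg z, Finset.prod_insert ha, ← h]
      field_simp
      ring

lemma factor_norm_le {R : ℝ} (hR : 1 ≤ R) (S : Finset ℂ) (hS : ∀ ρ ∈ S, F ρ = 0)
    (hSR : ∀ ρ ∈ S, ‖ρ‖ ≤ R) {g : ℂ → ℂ} (hg : Differentiable ℂ g)
    (hFg : ∀ z, F z = (∏ ρ ∈ S, (1 - z / ρ)) * g z) {z : ℂ} (hz : ‖z‖ ≤ 4 * R) :
    3 ^ S.card * ‖g z‖ ≤ Real.exp (6 * R) := by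
  have hR0 : (4 * R) ≠ 0 := by positivity
  have key : ‖g z‖ ≤ Real.exp (6 * R) / 3 ^ S.card := by
    refine Complex.norm_le_of_forall_mem_frontier_norm_le (U := Metric.ball (0 : ℂ) (4 * R))
      Metric.isBounded_ball hg.diffContOnCl ?_ ?_
    · intro w hw
      rw [frontier_ball _ hR0, mem_sphere_zero_iff_norm] at hw
      rw [le_div_iff₀ (by positivity)]
      refine le_trans ?_ (F_bound hR hw)
      rw [hFg w, norm_mul, mul_comm]
      gcongr
      rw [norm_prod, ← Finset.prod_const]
      refine Finset.prod_le_prod (by intros; norm_num) ?_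
      intro ρ hρ
      have hρ0 : 0 < ‖ρ‖ := norm_pos_iff.mpr (zero_ne (hS ρ hρ))
      have h1 : ‖w / ρ‖ - ‖(1 : ℂ)‖ ≤ ‖w / ρ - 1‖ := norm_sub_norm_le _ _
      have h2 : 4 ≤ ‖w / ρ‖ := by
        rw [norm_div, hw, le_div_iff₀ hρ0]
        linarith [hSR ρ hρ]
      rw [norm_sub_rev, norm_one] at h1
      linarith
    · rw [closure_ball _ hR0]
      simpa using hz
  rw [le_div_iff₀ (by positivity)] at key
  linarith

lemma card_le {R : ℝ} (hR : 1 ≤ R) (S : Finset ℂ) (hS : ∀ ρ ∈ S, F ρ = 0)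
    (hSR : ∀ ρ ∈ S, ‖ρ‖ ≤ R) : (S.card : ℝ) ≤ 6 * R := by
  obtain ⟨g, hg, hFg⟩ := factor S hS
  have h := factor_norm_le hR S hS hSR hg hFg (z := 0) (by simp; linarith)
  have h0 : g 0 = 1 := by have := hFg 0; simpa [F_zero] using this.symm
  rw [h0, norm_one, mul_one] at h
  have h1 : Real.exp (S.card : ℝ) ≤ Real.exp (6 * R) := by
    refine le_trans ?_ h
    rw [← mul_one (S.card : ℝ), Real.exp_nat_mul]
    gcongr
    have := Real.exp_one_lt_d9
    linarith
  exact Real.exp_le_exp.mp h1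

lemma finite_zeros (R : ℝ) : {ρ : ℂ | F ρ = 0 ∧ ‖ρ‖ ≤ R}.Finite := by
  by_contra hinf
  obtain ⟨S, hS, hc⟩ := (Set.Infinite.exists_subset_card_eq (s := {ρ : ℂ | F ρ = 0 ∧ ‖ρ‖ ≤ R})
    hinf (⌊6 * max R 1⌋₊ + 1))
  have h := card_le (le_max_right R 1) S (fun ρ hρ => (hS hρ).1)
    (fun ρ hρ => (hS hρ).2.trans (le_max_left _ _))
  rw [hc] at h
  have := Nat.lt_floor_add_one (6 * max R 1)
  push_cast at h
  linarith

lemma sum_bound {R : ℝ} (hR : 1 ≤ R) (S : Finset ℂ) (hS : ∀ ρ, ρ ∈ S ↔ F ρ = 0 ∧ ‖ρ‖ ≤ R) :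
    ‖∑ ρ ∈ S, 1 / ρ ^ 2‖ ≤ 96 / R := by
  have hR0 : 0 < R := by linarith
  have hS1 : ∀ ρ ∈ S, F ρ = 0 := fun ρ hρ => ((hS ρ).mp hρ).1
  have hS2 : ∀ ρ ∈ S, ‖ρ‖ ≤ R := fun ρ hρ => ((hS ρ).mp hρ).2
  obtain ⟨g, hg, hFg⟩ := factor S hS1
  have h0 : g 0 = 1 := by have := hFg 0; simpa [F_zero] using this.symm
  have hPd : Differentiable ℂ (fun z : ℂ => ∏ ρ ∈ S, (1 - z / ρ)) := by fun_prop
  have hFg' : F = fun z => (∏ ρ ∈ S, (1 - z / ρ)) * g z := funext hFg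
  have hgne : ∀ z ∈ Metric.ball (0 : ℂ) R, g z ≠ 0 := by
    intro z hz hgz
    have hFz : F z = 0 := by rw [hFg, hgz, mul_zero]
    have hzS : z ∈ S := (hS z).mpr ⟨hFz, (mem_ball_zero_iff.mp hz).le⟩
    refine simple hFz ?_
    have hd := ((hPd z).hasDerivAt.mul (hg z).hasDerivAt).deriv
    have hP0 : ∏ ρ ∈ S, (1 - z / ρ) = 0 :=
      Finset.prod_eq_zero hzS (by rw [div_self (zero_ne hFz), sub_self])
    have h2 : deriv F z = deriv ((fun z : ℂ => ∏ ρ ∈ S, (1 - z / ρ)) * g) z := by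
      rw [hFg']; rfl
    rw [h2, hd, hgz, hP0]
    simp
  have hg' : Differentiable ℂ (deriv g) := by
    rw [← differentiableOn_univ] at hg ⊢
    exact hg.deriv isOpen_univ
  have hld : DifferentiableOn ℂ (fun z => deriv g z / g z) (Metric.ball (0 : ℂ) R) :=
    hg'.differentiableOn.div hg.differentiableOn hgne
  obtain ⟨h₁, hh₁⟩ := hld.isExactOn_ball
  set h : ℂ → ℂ := fun z => h₁ z - h₁ 0 with hdef
  have hh : ∀ z ∈ Metric.ball (0 : ℂ) R, HasDerivAt h (deriv g z / g z) z :=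
    fun z hz => (hh₁ z hz).sub_const _
  have hz0 : (0 : ℂ) ∈ Metric.ball (0 : ℂ) R := by simpa using hR0
  have hh0 : h 0 = 0 := by simp [hdef]
  have hexp : ∀ z ∈ Metric.ball (0 : ℂ) R, Complex.exp (h z) = g z := by
    intro z hz
    have hder : ∀ w ∈ Metric.ball (0 : ℂ) R,
        HasDerivAt (fun w => g w * Complex.exp (-h w)) 0 w := by
      intro w hw
      have h1 := (hg w).hasDerivAt.mul ((hh w hw).neg.cexp)
      refine h1.congr_deriv ?_
      have := hgne w hw
      simp only [Pi.neg_apply]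
      field_simp
      ring
    have h2 := Metric.isOpen_ball.is_const_of_deriv_eq_zero (convex_ball (0 : ℂ) R).isPreconnected
      (fun w hw => (hder w hw).differentiableAt.differentiableWithinAt)
      (fun w hw => (hder w hw).deriv) hz hz0
    simp only [hh0, h0, neg_zero, Complex.exp_zero, mul_one, Complex.exp_neg] at h2
    have h3 := Complex.exp_ne_zero (h z)
    field_simp at h2
    exact h2.symm
  have hre : Set.MapsTo h (Metric.ball (0 : ℂ) R) {z | z.re ≤ 6 * R} := by
    intro z hz
    have hzR := mem_ball_zero_iff.mp hz
    have h1 := factor_norm_le hR S hS1 hS2 hg hFg (z := z) (by linarith)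
    have h2 : ‖g z‖ ≤ 3 ^ S.card * ‖g z‖ :=
      le_mul_of_one_le_left (norm_nonneg _) (one_le_pow₀ (by norm_num))
    rw [← hexp z hz, Complex.norm_exp] at h2 h1
    exact Real.exp_le_exp.mp (h2.trans h1)
  have hhd : DifferentiableOn ℂ h (Metric.ball (0 : ℂ) R) :=
    fun z hz => (hh z hz).differentiableAt.differentiableWithinAt
  have hbc : ∀ z ∈ Metric.sphere (0 : ℂ) (R / 2), ‖h z‖ ≤ 12 * R := by
    intro z hz
    rw [mem_sphere_zero_iff_norm] at hz
    have h1 := Complex.borelCaratheodory_zero (M := 6 * R) (by positivity) hhd hre hR0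
      (z := z) (by rw [mem_ball_zero_iff, hz]; linarith) hh0
    rw [hz] at h1
    refine h1.trans (le_of_eq ?_)
    field_simp
    ring
  have hcauchy := Complex.norm_iteratedDeriv_le_of_forall_mem_sphere_norm_le 2
    (by positivity : 0 < R / 2)
    (DifferentiableOn.diffContOnCl (by
      rw [closure_ball _ (by positivity)]
      exact hhd.mono (Metric.closedBall_subset_ball (by linarith)))) hbc
  have hsum : iteratedDeriv 2 h 0 = ∑ ρ ∈ S, 1 / ρ ^ 2 := by
    rw [iteratedDeriv_succ, iteratedDeriv_one]
    have hev : deriv h =ᶠ[nhds 0] fun z => (Complex.exp z - 2) / F z -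
        ∑ ρ ∈ S, (-1 / ρ) / (1 - z / ρ) := by
      have hFne : ∀ᶠ z in nhds (0 : ℂ), F z ≠ 0 :=
        F_diff.continuous.continuousAt.eventually_ne (by simp [F_zero])
      filter_upwards [hFne, Metric.isOpen_ball.mem_nhds hz0] with z hFz hz
      rw [(hh z hz).deriv]
      have hPg : (∏ ρ ∈ S, (1 - z / ρ)) ≠ 0 := by
        intro h; apply hFz; rw [hFg, h, zero_mul]
      have hfac : ∀ ρ ∈ S, (1 - z / ρ) ≠ 0 := Finset.prod_ne_zero_iff.mp hPg
      have hl := logDeriv_mul z hPg (hgne z hz) (hPd z) (hg z)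
      rw [← hFg', logDeriv_prod hfac (by intros; fun_prop), logDeriv_apply, logDeriv_apply,
        F_deriv] at hl
      have hl2 : ∀ ρ ∈ S, logDeriv (fun z : ℂ => 1 - z / ρ) z = (-1 / ρ) / (1 - z / ρ) := by
        intro ρ _
        rw [logDeriv_apply]
        congr 1
        have := (((hasDerivAt_id z).div_const ρ).const_sub 1).deriv
        simp only [id] at this
        rw [this]; ring
      rw [Finset.sum_congr rfl hl2] at hl
      rw [hl]; ring
    rw [hev.deriv_eq]
    have hA : HasDerivAt (fun z => (Complex.exp z - 2) / F z) 0 0 := by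
      have := ((Complex.hasDerivAt_exp 0).sub_const 2).div (F_hasDerivAt 0) (by simp [F_zero])
      refine this.congr_deriv ?_
      simp [F_zero]; norm_num
    have hB : ∀ ρ ∈ S, HasDerivAt (fun z : ℂ => (-1 / ρ) / (1 - z / ρ)) (-(1 / ρ ^ 2)) 0 := by
      intro ρ hρ
      have hρ0 := zero_ne (hS1 ρ hρ)
      have := (hasDerivAt_const (0 : ℂ) (-1 / ρ)).div
        (((hasDerivAt_id (0 : ℂ)).div_const ρ).const_sub 1) (by simp)
      refine this.congr_deriv ?_
      simp
      field_simp
    have := (hA.sub (HasDerivAt.fun_sum hB)).deriv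
    refine Eq.trans this ?_
    simp
  rw [hsum] at hcauchy
  refine hcauchy.trans (le_of_eq ?_)
  simp [Nat.factorial]
  field_simp
  norm_num

lemma level {x : ℝ} (hx : 1 / 4 < x) : ∃ j : ℕ, x ≤ 2 ^ j ∧ (2 : ℝ) ^ j ≤ 4 * x := by
  rcases le_or_gt x 1 with h | h
  · exact ⟨0, by simpa using h, by simp; linarith⟩
  · obtain ⟨n, h1, h2⟩ := exists_nat_pow_near h.le (by norm_num : (1 : ℝ) < 2)
    refine ⟨n + 1, h2.le, ?_⟩
    rw [pow_succ]; linarith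

lemma sum_norm_le (S : Finset ℂ) (hS : ∀ ρ ∈ S, F ρ = 0) :
    ∑ ρ ∈ S, 1 / ‖ρ‖ ^ 2 ≤ 192 := by
  classical
  have hex : ∀ ρ : ℂ, ∃ j : ℕ, F ρ = 0 → ‖ρ‖ ≤ 2 ^ j ∧ (2 : ℝ) ^ j ≤ 4 * ‖ρ‖ := by
    intro ρ
    by_cases h : F ρ = 0
    · obtain ⟨j, hj⟩ := level (norm_gt h)
      exact ⟨j, fun _ => hj⟩
    · exact ⟨0, fun h' => absurd h' h⟩
  choose J hJ using hex
  have h1 : ∑ ρ ∈ S, 1 / ‖ρ‖ ^ 2 ≤ ∑ ρ ∈ S, 16 / (4 : ℝ) ^ (J ρ) := by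
    refine Finset.sum_le_sum fun ρ hρ => ?_
    have hj := (hJ ρ (hS ρ hρ)).2
    have hn := norm_gt (hS ρ hρ)
    rw [div_le_div_iff₀ (by positivity) (by positivity)]
    have : (4 : ℝ) ^ J ρ = (2 ^ J ρ) ^ 2 := by rw [← pow_mul, mul_comm, pow_mul]; norm_num
    rw [this]
    have h0 : (0 : ℝ) < 2 ^ J ρ := by positivity
    nlinarith
  refine h1.trans ?_
  rw [← Finset.sum_fiberwise_of_maps_to (t := S.image J)
    (fun ρ hρ => Finset.mem_image_of_mem J hρ)]
  have h2 : ∀ j ∈ S.image J, ∑ ρ ∈ S with J ρ = j, 16 / (4 : ℝ) ^ (J ρ) ≤ 96 * (1 / 2) ^ j := by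
    intro j _
    have h3 : ∑ ρ ∈ S with J ρ = j, 16 / (4 : ℝ) ^ (J ρ)
        = ((S.filter (fun ρ => J ρ = j)).card : ℝ) * (16 / 4 ^ j) := by
      rw [← nsmul_eq_mul, ← Finset.sum_const]
      refine Finset.sum_congr rfl fun ρ hρ => ?_
      rw [(Finset.mem_filter.mp hρ).2]
    have h4 := card_le (R := 2 ^ j) (one_le_pow₀ (by norm_num)) (S.filter (fun ρ => J ρ = j))
      (fun ρ hρ => hS ρ (Finset.mem_filter.mp hρ).1)
      (fun ρ hρ => by
        obtain ⟨ha, hb⟩ := Finset.mem_filter.mp hρ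
        exact hb ▸ (hJ ρ (hS ρ ha)).1)
    rw [h3]
    calc _ ≤ 6 * 2 ^ j * (16 / (4 : ℝ) ^ j) := by gcongr
      _ = 96 * (1 / 2) ^ j := by
        rw [show (4 : ℝ) ^ j = 2 ^ j * 2 ^ j by rw [← mul_pow]; norm_num, one_div, inv_pow]
        field_simp
        norm_num
  refine (Finset.sum_le_sum h2).trans ?_
  rw [← Finset.mul_sum]
  have h5 := (summable_geometric_two).sum_le_tsum (S.image J) (fun _ _ => by positivity)
  rw [tsum_geometric_two] at h5
  linarith

end ExpZeros

/-- The zeros `ρ` of `e^z - 2z`, counted with multiplicity `k_ρ`, satisfy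
`∑_ρ k_ρ/ρ² = 0` (with absolute convergence). -/
theorem sum_inv_sq_zeros_exp_sub_two_mul (k : ℂ → ℕ)
    (hk : ∀ ρ : ℂ, Complex.exp ρ = 2 * ρ →
      ∃ h : AnalyticAt ℂ (fun z => Complex.exp z - 2 * z) ρ, analyticOrderAt (fun z => Complex.exp z - 2 * z) ρ = (k ρ : ℕ∞)) :
    Summable (fun ρ : {ρ : ℂ // Complex.exp ρ = 2 * ρ} => (k ρ : ℂ) / (ρ : ℂ) ^ 2) ∧
    ∑' ρ : {ρ : ℂ // Complex.exp ρ = 2 * ρ}, (k ρ : ℂ) / (ρ : ℂ) ^ 2 = 0 := by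
  classical
  have hF : ∀ ρ : {ρ : ℂ // Complex.exp ρ = 2 * ρ}, ExpZeros.F ρ = 0 :=
    fun ρ => sub_eq_zero.mpr ρ.2
  have hk1 : ∀ ρ : {ρ : ℂ // Complex.exp ρ = 2 * ρ}, k ρ = 1 := by
    intro ρ
    obtain ⟨ha, ho⟩ := hk ρ ρ.2
    have h1 := ha.analyticOrderAt_sub_eq_one_of_deriv_ne_zero (ExpZeros.simple (hF ρ))
    have h2 : Complex.exp (ρ : ℂ) - 2 * ρ = 0 := hF ρ
    simp only [h2, sub_zero] at h1
    rw [ho] at h1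
    exact_mod_cast h1
  have hfun : (fun ρ : {ρ : ℂ // Complex.exp ρ = 2 * ρ} => (k ρ : ℂ) / (ρ : ℂ) ^ 2)
      = fun ρ : {ρ : ℂ // Complex.exp ρ = 2 * ρ} => 1 / (ρ : ℂ) ^ 2 := by
    funext ρ; rw [hk1 ρ]; simp
  rw [hfun]
  have hsummable : Summable
      (fun ρ : {ρ : ℂ // Complex.exp ρ = 2 * ρ} => 1 / (ρ : ℂ) ^ 2) := by
    refine Summable.of_norm (summable_of_sum_le (c := 192) (fun _ => norm_nonneg _) ?_)
    intro u
    have := ExpZeros.sum_norm_le (u.map (Function.Embedding.subtype _)) (by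
      intro ρ hρ
      obtain ⟨x, _, rfl⟩ := Finset.mem_map.mp hρ
      exact hF x)
    rw [Finset.sum_map] at this
    simpa using this
  refine ⟨hsummable, ?_⟩
  let T : ℕ → Finset ℂ := fun n => (ExpZeros.finite_zeros ((n : ℝ) + 1)).toFinset
  have hT : ∀ n ρ, ρ ∈ T n ↔ ExpZeros.F ρ = 0 ∧ ‖ρ‖ ≤ (n : ℝ) + 1 := by
    intro n ρ; simp [T]
  let U : ℕ → Finset {ρ : ℂ // Complex.exp ρ = 2 * ρ} := fun n => (T n).subtype _
  have hU : Filter.Tendsto U Filter.atTop Filter.atTop := by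
    refine Filter.tendsto_atTop_finset_of_monotone ?_ ?_
    · intro m n hmn ρ hρ
      simp only [U, Finset.mem_subtype, hT] at hρ ⊢
      have : (m : ℝ) ≤ n := by exact_mod_cast hmn
      exact ⟨hρ.1, by linarith [hρ.2]⟩
    · intro ρ
      obtain ⟨n, hn⟩ := exists_nat_ge ‖(ρ : ℂ)‖
      refine ⟨n, ?_⟩
      simp only [U, Finset.mem_subtype, hT]
      exact ⟨hF ρ, by linarith⟩
  have hlim := hsummable.hasSum.comp hU
  refine tendsto_nhds_unique hlim ?_
  have hz : Filter.Tendsto (fun n : ℕ => 96 * (1 / ((n : ℝ) + 1))) Filter.atTop (nhds 0) := by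
    simpa using (tendsto_one_div_add_atTop_nhds_zero_nat (𝕜 := ℝ)).const_mul 96
  refine squeeze_zero_norm (fun n => ?_) hz
  have hb := ExpZeros.sum_bound (R := (n : ℝ) + 1) (by simp) (T n) (hT n)
  have he : ∑ ρ ∈ U n, 1 / (ρ : ℂ) ^ 2 = ∑ ρ ∈ T n, 1 / ρ ^ 2 := by
    have := Finset.sum_subtype_of_mem (s := T n) (p := fun ρ : ℂ => Complex.exp ρ = 2 * ρ)
      (fun ρ : ℂ => 1 / ρ ^ 2) (fun ρ hρ => sub_eq_zero.mp ((hT n ρ).mp hρ).1)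
    exact this
  simp only [Function.comp]
  rw [he]
  refine hb.trans (le_of_eq ?_)
  ring
end

section
/- Let s be a complex number with s ∉ {0, −1, −2, −3, …}, and let f_s be the entire function f_s(z) = ∑_{n=0}^∞ (−1)^n z^n/(n!·(s+n)) (which equals z^{−s}γ(s,z), where γ(s,z) is the lower incomplete gamma function). Let Z be the set of zeros of f_s and for ρ ∈ Z let k_ρ be the order of the zero at ρ. Then the series ∑_{ρ∈Z} k_ρ/ρ² converges absolutely and ∑_{ρ∈Z} k_ρ/ρ² = −s/((s+1)²(s+2)). -/
open Complex

namespace IncGamma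
open Filter Topology Metric

lemma step (g : ℂ → ℂ) (hg : Differentiable ℂ g) (a : ℂ) (ha : a ≠ 0) (n : ℕ)
    (hn : analyticOrderAt g a = (n : ℕ∞)) :
    ∃ h : ℂ → ℂ, Differentiable ℂ h ∧ h a ≠ 0 ∧ ∀ z, g z = (1 - z / a) ^ n * h z := by
  obtain ⟨q, hq, hqa, hev⟩ := (hg.analyticAt a).analyticOrderAt_eq_natCast.1 hn
  have key : ∀ z, (z - a) ^ n = (1 - z / a) ^ n * (-a) ^ n := by
    intro z
    rw [← mul_pow]; congr 1; field_simp; ring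
  have hne : ∀ z, z ≠ a → (1 - z / a) ^ n ≠ 0 := by
    intro z hz
    apply pow_ne_zero
    intro h0
    apply hz
    field_simp at h0
    linear_combination -h0
  have hh : ∀ᶠ z in 𝓝 a, (if z = a then (-a) ^ n * q a else g z / (1 - z / a) ^ n)
      = (-a) ^ n * q z := by
    filter_upwards [hev] with z hz
    split_ifs with h
    · rw [h]
    · rw [hz, key, smul_eq_mul]
      have := hne z h
      field_simp
  refine ⟨fun z => if z = a then (-a) ^ n * q a else g z / (1 - z / a) ^ n, ?_, ?_, ?_⟩
  · intro z
    by_cases hz : z = a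
    · subst hz
      refine DifferentiableAt.congr_of_eventuallyEq ?_ hh
      exact hq.differentiableAt.const_mul _
    · have : (fun w => g w / (1 - w / a) ^ n) =ᶠ[𝓝 z]
          (fun z => if z = a then (-a) ^ n * q a else g z / (1 - z / a) ^ n) := by
        filter_upwards [isOpen_ne.mem_nhds hz] with w hw
        rw [if_neg hw]
      refine DifferentiableAt.congr_of_eventuallyEq ?_ this.symm
      exact (hg z).div (by fun_prop) (hne z hz)
  · simp [ha, hqa]
  · intro z
    by_cases hz : z = a
    · subst hz
      have := hev.self_of_nhds
      simp only [if_true]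
      rw [this, key, smul_eq_mul]; ring
    · simp only [if_neg hz]
      have := hne z hz
      field_simp

lemma factor (f : ℂ → ℂ) (hf : Differentiable ℂ f) (k : ℂ → ℕ) (S : Finset ℂ)
    (h0 : ∀ ρ ∈ S, ρ ≠ 0) (hk : ∀ ρ ∈ S, analyticOrderAt f ρ = (k ρ : ℕ∞)) :
    ∃ g : ℂ → ℂ, Differentiable ℂ g ∧ (∀ ρ ∈ S, g ρ ≠ 0) ∧
      ∀ z, f z = (∏ ρ ∈ S, (1 - z / ρ) ^ k ρ) * g z := by
  induction S using Finset.induction_on with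
  | empty => exact ⟨f, hf, by simp, by simp⟩
  | insert a S ha ih =>
    obtain ⟨g, hg, hgS, hfg⟩ := ih (fun ρ h => h0 ρ (Finset.mem_insert_of_mem h))
      (fun ρ h => hk ρ (Finset.mem_insert_of_mem h))
    have ha0 := h0 a (Finset.mem_insert_self _ _)
    have hPd : Differentiable ℂ (fun z => ∏ ρ ∈ S, (1 - z / ρ) ^ k ρ) := by fun_prop
    have hPa : (fun z => ∏ ρ ∈ S, (1 - z / ρ) ^ k ρ) a ≠ 0 := by
      simp only
      refine Finset.prod_ne_zero_iff.2 fun ρ hρ => pow_ne_zero _ ?_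
      have hρ0 := h0 ρ (Finset.mem_insert_of_mem hρ)
      intro h
      field_simp at h
      have h' : ρ = a := by linear_combination h
      exact ha (h' ▸ hρ)
    have hord : analyticOrderAt g a = (k a : ℕ∞) := by
      rw [← hk a (Finset.mem_insert_self _ _)]
      have : f = (fun z => ∏ ρ ∈ S, (1 - z / ρ) ^ k ρ) * g := funext hfg
      rw [this, analyticOrderAt_mul (hPd.analyticAt a) (hg.analyticAt a),
        (hPd.analyticAt a).analyticOrderAt_eq_zero.2 hPa, zero_add]
    obtain ⟨h, hh, hha, hgh⟩ := step g hg a ha0 (k a) hord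
    refine ⟨h, hh, ?_, ?_⟩
    · intro ρ hρ
      rcases Finset.mem_insert.1 hρ with rfl | hρ
      · exact hha
      · intro h'
        apply hgS ρ hρ
        rw [hgh, h', mul_zero]
    · intro z
      rw [Finset.prod_insert ha, hfg, hgh]; ring

lemma logD (f g : ℂ → ℂ) (hg : Differentiable ℂ g) (k : ℂ → ℕ) (S : Finset ℂ)
    (h0 : ∀ ρ ∈ S, ρ ≠ 0) (hg0 : g 0 ≠ 0)
    (hfg : ∀ z, f z = (∏ ρ ∈ S, (1 - z / ρ) ^ k ρ) * g z) :
    deriv (logDeriv g) 0 = deriv (logDeriv f) 0 + ∑ ρ ∈ S, (k ρ : ℂ) / ρ ^ 2 := by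
  have e1 : ∀ᶠ z in 𝓝 (0:ℂ), g z ≠ 0 := hg.continuous.continuousAt.eventually_ne hg0
  have e2 : ∀ᶠ z in 𝓝 (0:ℂ), ∀ ρ ∈ S, 1 - z / ρ ≠ 0 := by
    rw [Filter.eventually_all_finset]
    intro ρ hρ
    have : ContinuousAt (fun z : ℂ => 1 - z / ρ) 0 := by fun_prop
    exact this.eventually_ne (by simp)
  have ev : logDeriv f =ᶠ[𝓝 0]
      fun z => (∑ ρ ∈ S, (k ρ : ℂ) * (z - ρ)⁻¹) + logDeriv g z := by
    filter_upwards [e1, e2] with z hz1 hz2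
    rw [show f = fun z => (∏ ρ ∈ S, (1 - z / ρ) ^ k ρ) * g z from funext hfg,
      logDeriv_mul z (Finset.prod_ne_zero_iff.2 fun ρ hρ => pow_ne_zero _ (hz2 ρ hρ)) hz1
        (by fun_prop) (hg z),
      logDeriv_prod (f := fun ρ z => (1 - z / ρ) ^ k ρ) (fun ρ hρ => pow_ne_zero _ (hz2 ρ hρ))
        (by fun_prop)]
    congr 1
    refine Finset.sum_congr rfl fun ρ hρ => ?_
    rw [logDeriv_fun_pow (by fun_prop)]
    congr 1
    have a1 := hz2 ρ hρ
    have a2 := h0 ρ hρ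
    have a3 : z - ρ ≠ 0 := by
      intro h; apply a1; rw [sub_eq_zero.1 h]; field_simp; simp
    rw [logDeriv_apply]
    simp only [deriv_const_sub, deriv_div_const, deriv_id'']
    have a4 : (1 - z / ρ) = - (z - ρ) / ρ := by field_simp; ring
    rw [a4]
    field_simp
  have hd1 : HasDerivAt (fun z : ℂ => ∑ ρ ∈ S, (k ρ : ℂ) * (z - ρ)⁻¹)
      (∑ ρ ∈ S, (k ρ : ℂ) * (-1 / (0 - ρ) ^ 2)) 0 := by
    apply HasDerivAt.fun_sum
    intro ρ hρ
    apply HasDerivAt.const_mul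
    exact ((hasDerivAt_id' (0:ℂ)).sub_const ρ).inv (by simpa using h0 ρ hρ)
  have hd2 : DifferentiableAt ℂ (logDeriv g) 0 := by
    have : AnalyticAt ℂ (logDeriv g) 0 := (hg.analyticAt 0).deriv.div (hg.analyticAt 0) hg0
    exact this.differentiableAt
  rw [ev.deriv_eq, deriv_fun_add hd1.differentiableAt hd2, hd1.deriv]
  have : ∑ ρ ∈ S, (k ρ : ℂ) * (-1 / (0 - ρ) ^ 2) = - ∑ ρ ∈ S, (k ρ : ℂ) / ρ ^ 2 := by
    rw [← Finset.sum_neg_distrib]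
    refine Finset.sum_congr rfl fun ρ _ => ?_
    simp; ring
  rw [this]; ring

lemma bc (g : ℂ → ℂ) (hg : Differentiable ℂ g) (R B : ℝ) (hR : 0 < R) (hB : 0 < B)
    (hne : ∀ z ∈ ball (0:ℂ) R, g z ≠ 0) (hb : ∀ z ∈ ball (0:ℂ) R, ‖g z‖ ≤ ‖g 0‖ * Real.exp B) :
    ‖deriv (logDeriv g) 0‖ ≤ 2 * (2 * B) / (R / 2) ^ 2 := by
  have hdl : DifferentiableOn ℂ (logDeriv g) (ball 0 R) := by
    intro z hz
    have : AnalyticAt ℂ (logDeriv g) z := (hg.analyticAt z).deriv.div (hg.analyticAt z) (hne z hz)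
    exact this.differentiableAt.differentiableWithinAt
  obtain ⟨L, hL0, hL⟩ := hdl.isExactOn_ball.with_val_at 0 0
  have h00 : (0:ℂ) ∈ ball (0:ℂ) R := mem_ball_self hR
  have hLd : DifferentiableOn ℂ L (ball 0 R) := fun z hz =>
    (hL z hz).differentiableAt.differentiableWithinAt
  have hc : ∀ z ∈ ball (0:ℂ) R, g z * cexp (- L z) = g 0 := by
    intro z hz
    have hD : ∀ z ∈ ball (0:ℂ) R, HasDerivAt (fun z => g z * cexp (- L z)) 0 z := by
      intro z hz
      have := (hg z).hasDerivAt.mul (hL z hz).neg.cexp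
      convert! this using 1
      rw [logDeriv_apply]
      have := hne z hz
      simp only [Pi.neg_apply]
      field_simp
      ring
    have := isOpen_ball.is_const_of_deriv_eq_zero (convex_ball (0:ℂ) R).isPreconnected
      (fun z hz => (hD z hz).differentiableAt.differentiableWithinAt)
      (fun z hz => (hD z hz).deriv) hz h00
    simpa [hL0] using this
  have hre : Set.MapsTo L (ball 0 R) {z | z.re ≤ B} := by
    intro z hz
    have h1 := hc z hz
    have h2 : g z = g 0 * cexp (L z) := by
      rw [← h1, mul_assoc, ← Complex.exp_add]; simp
    have h3 := hb z hz
    rw [h2, norm_mul, Complex.norm_exp] at h3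
    have h4 := le_of_mul_le_mul_left h3 (norm_pos_iff.2 (hne 0 h00))
    exact Real.exp_le_exp.1 h4
  have hnorm : ∀ z ∈ sphere (0:ℂ) (R/2), ‖L z‖ ≤ 2 * B := by
    intro z hz
    have hz' : ‖z‖ = R / 2 := by simpa using hz
    have := borelCaratheodory_zero hB hLd hre hR (z := z) (by simp [hz']; linarith) hL0
    rw [hz'] at this
    refine this.trans (le_of_eq ?_)
    field_simp; ring
  have hsub : closedBall (0:ℂ) (R/2) ⊆ ball 0 R := closedBall_subset_ball (by linarith)
  have hcl : DiffContOnCl ℂ L (ball 0 (R/2)) := (hLd.mono hsub).diffContOnCl_ball (Set.Subset.refl _)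
  have := norm_iteratedDeriv_le_of_forall_mem_sphere_norm_le 2 (by linarith) hcl hnorm
  have e : iteratedDeriv 2 L 0 = deriv (logDeriv g) 0 := by
    rw [iteratedDeriv_succ, iteratedDeriv_one]
    apply Filter.EventuallyEq.deriv_eq
    filter_upwards [isOpen_ball.mem_nhds h00] with z hz using (hL z hz).deriv
  rw [e] at this
  simpa using this

lemma key (f : ℂ → ℂ) (hf : Differentiable ℂ f) (hf0 : f 0 ≠ 0) (M : ℝ)
    (hM : ∀ z, ‖f z‖ ≤ M * Real.exp ‖z‖) (k : ℂ → ℕ)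
    (hk : ∀ ρ, f ρ = 0 → analyticOrderAt f ρ = (k ρ : ℕ∞)) (R : ℝ) (hR : 0 < R)
    (S : Finset ℂ) (hS : ∀ z, z ∈ S ↔ f z = 0 ∧ ‖z‖ ≤ R) :
    (∑ ρ ∈ S, (k ρ : ℝ)) ≤ Real.log (M / ‖f 0‖) + 4 * R ∧
    ‖deriv (logDeriv f) 0 + ∑ ρ ∈ S, (k ρ : ℂ) / ρ ^ 2‖ ≤
      2 * (2 * (Real.log (M / ‖f 0‖) + 4 * R)) / (R / 2) ^ 2 := by
  have hS0 : ∀ ρ ∈ S, ρ ≠ 0 := by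
    rintro ρ hρ rfl
    exact hf0 ((hS 0).1 hρ).1
  obtain ⟨g, hg, hgS, hfg⟩ := factor f hf k S hS0 (fun ρ hρ => hk ρ ((hS ρ).1 hρ).1)
  have hf0' : 0 < ‖f 0‖ := norm_pos_iff.2 hf0
  have hM0 : ‖f 0‖ ≤ M := by simpa using hM 0
  have hMp : 0 < M := hf0'.trans_le hM0
  have hA : 0 ≤ Real.log (M / ‖f 0‖) := Real.log_nonneg (by rwa [le_div_iff₀ hf0', one_mul])
  have hg0 : g 0 = f 0 := by rw [hfg 0]; simp
  have hP : ∀ z, ‖z‖ = 4 * R → (3:ℝ) ^ (∑ ρ ∈ S, k ρ) ≤ ‖∏ ρ ∈ S, (1 - z / ρ) ^ k ρ‖ := by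
    intro z hz
    rw [norm_prod, ← Finset.prod_pow_eq_pow_sum]
    refine Finset.prod_le_prod (fun _ _ => by positivity) fun ρ hρ => ?_
    rw [norm_pow]
    gcongr
    have h1 : ‖z / ρ‖ - ‖(1:ℂ)‖ ≤ ‖z / ρ - 1‖ := norm_sub_norm_le _ _
    rw [norm_sub_rev, norm_div, hz, norm_one] at h1
    have h2 : 0 < ‖ρ‖ := norm_pos_iff.2 (hS0 ρ hρ)
    have h3 : 4 ≤ 4 * R / ‖ρ‖ := by
      rw [le_div_iff₀ h2]; linarith [((hS ρ).1 hρ).2]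
    linarith
  set n := ∑ ρ ∈ S, k ρ with hn
  have h3n : (0:ℝ) < 3 ^ n := by positivity
  have hgb : ∀ z, ‖z‖ ≤ 4 * R → ‖g z‖ ≤ M * Real.exp (4 * R) / 3 ^ n := by
    intro z hz
    refine norm_le_of_forall_mem_frontier_norm_le (U := ball 0 (4*R)) isBounded_ball
      hg.diffContOnCl ?_ ?_
    · intro w hw
      rw [frontier_ball _ (by positivity)] at hw
      have hw : ‖w‖ = 4 * R := by simpa using hw
      rw [le_div_iff₀ h3n]
      calc ‖g w‖ * 3 ^ n ≤ ‖g w‖ * ‖∏ ρ ∈ S, (1 - w / ρ) ^ k ρ‖ := by gcongr; exact hP w hw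
        _ = ‖f w‖ := by rw [hfg w, norm_mul, mul_comm]
        _ ≤ _ := by rw [← hw]; exact hM w
    · rw [closure_ball _ (by positivity)]; simpa using hz
  have hexp : M * Real.exp (4 * R) = ‖f 0‖ * Real.exp (Real.log (M / ‖f 0‖) + 4 * R) := by
    rw [Real.exp_add, Real.exp_log (by positivity)]; field_simp
  constructor
  · have h1 := hgb 0 (by simp; positivity)
    rw [hg0, le_div_iff₀ h3n, hexp] at h1
    have h2 := le_of_mul_le_mul_left h1 hf0'
    have h4 : Real.exp n ≤ 3 ^ n := by
      rw [← Real.exp_one_pow]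
      gcongr
      linarith [Real.exp_one_lt_d9]
    have := Real.exp_le_exp.1 (h4.trans h2)
    rw [hn] at this
    push_cast at this
    exact this
  · rw [← logD f g hg k S hS0 (by rwa [hg0]) hfg]
    refine bc g hg R _ hR (by positivity) ?_ ?_
    · intro z hz hz0
      have hfz : f z = 0 := by rw [hfg, hz0, mul_zero]
      have : ‖z‖ < R := by simpa using hz
      exact hgS z ((hS z).2 ⟨hfz, this.le⟩) hz0
    · intro z hz
      have : ‖z‖ < R := by simpa using hz
      rw [hg0, ← hexp]
      refine (hgb z (by linarith)).trans (div_le_self (by positivity) ?_)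
      exact one_le_pow₀ (by norm_num)

lemma summ {ι : Type*} (w a : ι → ℝ) (hw : ∀ i, 0 ≤ w i) (a0 A : ℝ) (ha0 : 0 < a0) (hA : 0 ≤ A)
    (ha : ∀ i, a0 ≤ a i)
    (h : ∀ R > 0, ∀ u : Finset ι, (∀ i ∈ u, a i ≤ R) → ∑ i ∈ u, w i ≤ A + 4 * R) :
    Summable (fun i => w i / a i ^ 2) := by
  classical
  have hex : ∀ i, ∃ j : ℕ, a i ≤ 2 ^ j * a0 := by
    intro i
    obtain ⟨j, hj⟩ := pow_unbounded_of_one_lt (a i / a0) (one_lt_two (α := ℝ))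
    exact ⟨j, by rw [div_lt_iff₀ ha0] at hj; exact hj.le⟩
  have hpt : ∀ i, ∃ j : ℕ, a i ≤ 2 ^ j * a0 ∧ 1 / a i ^ 2 ≤ 4 / a0 ^ 2 / 4 ^ j := by
    intro i
    have hai : 0 < a i := ha0.trans_le (ha i)
    refine ⟨Nat.find (hex i), Nat.find_spec (hex i), ?_⟩
    have : 2 ^ (Nat.find (hex i)) * a0 ≤ 2 * a i := by
      rcases hj : Nat.find (hex i) with _ | j
      · simp; linarith [ha i]
      · have := Nat.find_min (hex i) (m := j) (by omega)
        push Not at this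
        rw [pow_succ]; linarith
    rw [div_div, div_le_div_iff₀ (by positivity) (by positivity)]
    have h2 : (2 ^ (Nat.find (hex i)) * a0) ^ 2 ≤ (2 * a i) ^ 2 := by gcongr
    have h4 : (4:ℝ) ^ (Nat.find (hex i)) = (2 ^ (Nat.find (hex i))) ^ 2 := by
      rw [← pow_mul, mul_comm, pow_mul]; norm_num
    rw [h4]
    nlinarith
  choose j hj1 hj2 using hpt
  refine summable_of_sum_le (c := 4 / a0 ^ 2 * (A + 4 * a0) * 2)
    (fun i => div_nonneg (hw i) (sq_nonneg _)) fun u => ?_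
  set J := u.sup j + 1
  have hJ : ∀ i ∈ u, j i ∈ Finset.range J := fun i hi => by
    rw [Finset.mem_range]; exact Nat.lt_succ_of_le (Finset.le_sup hi)
  rw [← Finset.sum_fiberwise_of_maps_to hJ]
  calc _ ≤ ∑ m ∈ Finset.range J, 4 / a0 ^ 2 * (A + 4 * a0) * (1 / 2) ^ m := by
        refine Finset.sum_le_sum fun m _ => ?_
        have h1 : ∑ i ∈ u with j i = m, w i / a i ^ 2 ≤
            ∑ i ∈ u with j i = m, w i * (4 / a0 ^ 2 / 4 ^ m) := by
          refine Finset.sum_le_sum fun i hi => ?_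
          have := (Finset.mem_filter.1 hi).2
          rw [div_eq_mul_one_div]
          refine mul_le_mul_of_nonneg_left ?_ (hw i)
          rw [← this]; exact hj2 i
        rw [← Finset.sum_mul] at h1
        have h2 := h (2 ^ m * a0) (by positivity) (u.filter (j · = m)) (fun i hi => by
          have := (Finset.mem_filter.1 hi).2
          rw [← this]; exact hj1 i)
        refine h1.trans ((mul_le_mul_of_nonneg_right h2 (by positivity)).trans ?_)
        have h4 : (4:ℝ) ^ m = 2 ^ m * 2 ^ m := by rw [← mul_pow]; norm_num
        have h5 : (1:ℝ) ≤ 2 ^ m := one_le_pow₀ (by norm_num)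
        rw [h4, one_div, inv_pow]
        have : (A + 4 * (2 ^ m * a0)) ≤ (A + 4 * a0) * 2 ^ m := by nlinarith
        calc _ ≤ (A + 4 * a0) * 2 ^ m * (4 / a0 ^ 2 / (2 ^ m * 2 ^ m)) := by gcongr
          _ = _ := by field_simp
    _ ≤ _ := by
        rw [← Finset.mul_sum]
        gcongr
        have := summable_geometric_two.sum_le_tsum (Finset.range J) (fun _ _ => by positivity)
        rwa [tsum_geometric_two] at this

lemma finiteZ (f : ℂ → ℂ) (hf : Differentiable ℂ f) (hf0 : f 0 ≠ 0) (R : ℝ) :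
    {z | f z = 0 ∧ ‖z‖ ≤ R}.Finite := by
  by_contra hinf
  obtain ⟨x, -, hx⟩ := Set.Infinite.exists_accPt_of_subset_isCompact hinf
    (isCompact_closedBall (0:ℂ) R) (fun z hz => by simpa using hz.2)
  rw [accPt_iff_frequently_nhdsNE] at hx
  have han : AnalyticOnNhd ℂ f Set.univ := fun z _ => hf.analyticAt z
  have := han.eqOn_zero_of_preconnected_of_frequently_eq_zero
    isPreconnected_univ (Set.mem_univ x) (hx.mono fun z hz => hz.1)
  exact hf0 (this (Set.mem_univ 0))

theorem general (f : ℂ → ℂ) (hf : Differentiable ℂ f) (hf0 : f 0 ≠ 0) (M : ℝ)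
    (hM : ∀ z, ‖f z‖ ≤ M * Real.exp ‖z‖) (k : ℂ → ℕ)
    (hk : ∀ ρ, f ρ = 0 → analyticOrderAt f ρ = (k ρ : ℕ∞)) :
    Summable (fun ρ : {ρ : ℂ // f ρ = 0} => (k ρ : ℂ) / (ρ : ℂ) ^ 2) ∧
    ∑' ρ : {ρ : ℂ // f ρ = 0}, (k ρ : ℂ) / (ρ : ℂ) ^ 2 = - deriv (logDeriv f) 0 := by
  classical
  set S : ℝ → Finset ℂ := fun R => (finiteZ f hf hf0 R).toFinset with hSdef
  have hS : ∀ R z, z ∈ S R ↔ f z = 0 ∧ ‖z‖ ≤ R := by intro R z; simp [hSdef]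
  have hf0' : 0 < ‖f 0‖ := norm_pos_iff.2 hf0
  have hM0 : ‖f 0‖ ≤ M := by simpa using hM 0
  have hA : 0 ≤ Real.log (M / ‖f 0‖) := Real.log_nonneg (by rwa [le_div_iff₀ hf0', one_mul])
  obtain ⟨a0, ha0, hball⟩ := Metric.eventually_nhds_iff.1
    (hf.continuous.continuousAt.eventually_ne hf0 : ∀ᶠ z in 𝓝 (0:ℂ), f z ≠ 0)
  have hsum : Summable (fun ρ : {ρ : ℂ // f ρ = 0} => (k ρ : ℂ) / (ρ : ℂ) ^ 2) := by
    apply Summable.of_norm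
    have := summ (fun ρ : {ρ : ℂ // f ρ = 0} => (k ρ : ℝ)) (fun ρ => ‖(ρ:ℂ)‖) (fun _ => by positivity)
      a0 _ ha0 hA (fun ρ => by
        by_contra! hlt
        exact hball (y := (ρ:ℂ)) (by simpa using hlt) ρ.2) (fun R hR u hu => by
        refine le_trans ?_ (key f hf hf0 M hM k hk R hR (S R) (hS R)).1
        rw [← Finset.sum_image (f := fun z : ℂ => (k z : ℝ)) (g := Subtype.val) (s := u)
          (fun x _ y _ hxy => Subtype.ext hxy)]
        refine Finset.sum_le_sum_of_subset_of_nonneg ?_ (fun _ _ _ => by positivity)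
        intro z hz
        obtain ⟨ρ, hρ, rfl⟩ := Finset.mem_image.1 hz
        exact (hS R _).2 ⟨ρ.2, hu ρ hρ⟩)
    simpa using this
  refine ⟨hsum, ?_⟩
  have htend : Tendsto (fun N : ℕ => ((S N).subtype (fun ρ => f ρ = 0))) atTop atTop := by
    apply tendsto_atTop_finset_of_monotone
    · intro a b hab x hx
      simp only [Finset.mem_subtype, hS] at hx ⊢
      exact ⟨hx.1, hx.2.trans (by exact_mod_cast hab)⟩
    · intro x
      obtain ⟨N, hN⟩ := exists_nat_ge ‖(x:ℂ)‖
      exact ⟨N, by simp only [Finset.mem_subtype, hS]; exact ⟨x.2, hN⟩⟩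
  have t1 := hsum.hasSum.comp htend
  refine tendsto_nhds_unique t1 ?_
  have e : ∀ N : ℕ, ∑ ρ ∈ (S N).subtype (fun ρ => f ρ = 0), (k ρ : ℂ) / (ρ:ℂ) ^ 2 =
      ∑ ρ ∈ S N, (k ρ : ℂ) / ρ ^ 2 := by
    intro N
    exact Finset.sum_subtype_of_mem (fun ρ : ℂ => (k ρ : ℂ) / ρ ^ 2)
      (fun x hx => ((hS N x).1 hx).1)
  rw [tendsto_iff_norm_sub_tendsto_zero]
  have hlim : Tendsto (fun N : ℕ => 16 * Real.log (M / ‖f 0‖) * ((1:ℝ) / N) * ((1:ℝ) / N)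
      + 64 * ((1:ℝ) / N)) atTop (𝓝 0) := by
    have h1 := tendsto_one_div_atTop_nhds_zero_nat (𝕜 := ℝ)
    simpa using ((h1.const_mul (16 * Real.log (M / ‖f 0‖))).mul h1).add (h1.const_mul 64)
  refine squeeze_zero' (Eventually.of_forall fun _ => norm_nonneg _) ?_ hlim
  filter_upwards [eventually_gt_atTop 0] with N hN
  have hN' : (0:ℝ) < N := by exact_mod_cast hN
  simp only [Function.comp_apply]
  rw [e, sub_neg_eq_add, add_comm]
  refine (key f hf hf0 M hM k hk N hN' (S N) (hS N)).2.trans (le_of_eq ?_)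
  field_simp
  ring

/-! The concrete function. -/

noncomputable def F (s : ℂ) (z : ℂ) : ℂ :=
  ∑' n : ℕ, (-1) ^ n * z ^ n / ((Nat.factorial n : ℂ) * (s + n))

lemma bdd (s : ℂ) : ∃ M : ℝ, 0 ≤ M ∧ ∀ n : ℕ, ‖(s + n)⁻¹‖ ≤ M := by
  have h1 : Tendsto (fun n : ℕ => (s + n)⁻¹) atTop (𝓝 0) := by
    apply tendsto_inv₀_cobounded.comp
    rw [← tendsto_norm_atTop_iff_cobounded]
    refine tendsto_atTop_mono (f := fun n : ℕ => (n:ℝ) - ‖s‖) (fun n => ?_)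
      (tendsto_atTop_add_const_right _ _ tendsto_natCast_atTop_atTop)
    have := norm_sub_norm_le (n:ℂ) (-s)
    simpa [add_comm] using this
  obtain ⟨M, hM⟩ := h1.norm.bddAbove_range
  exact ⟨M, (norm_nonneg _).trans (hM ⟨0, rfl⟩), fun n => hM ⟨n, rfl⟩⟩

lemma term_le (s : ℂ) (M : ℝ) (hM : ∀ n : ℕ, ‖(s + n)⁻¹‖ ≤ M) (z : ℂ) (n : ℕ) :
    ‖(-1) ^ n * z ^ n / ((Nat.factorial n : ℂ) * (s + n))‖ ≤ M * (‖z‖ ^ n / n.factorial) := by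
  have : (-1) ^ n * z ^ n / ((Nat.factorial n : ℂ) * (s + n)) =
    (s + n)⁻¹ * ((-1) ^ n * z ^ n / n.factorial) := by
      rw [div_mul_eq_div_div, div_eq_mul_inv _ (s + n)]; ring
  rw [this, norm_mul]
  refine mul_le_mul (hM n) (by simp) (norm_nonneg _) ((norm_nonneg _).trans (hM n))

lemma F_bound (s : ℂ) (M : ℝ) (hM : ∀ n : ℕ, ‖(s + n)⁻¹‖ ≤ M) (z : ℂ) :
    ‖F s z‖ ≤ M * Real.exp ‖z‖ := by
  have h : HasSum (fun n : ℕ => M * (‖z‖ ^ n / n.factorial)) (M * Real.exp ‖z‖) := by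
    rw [Real.exp_eq_exp_ℝ]
    exact (NormedSpace.expSeries_div_hasSum_exp ‖z‖).mul_left M
  exact tsum_of_norm_bounded h (term_le s M hM z)

lemma F_zero (s : ℂ) : F s 0 = 1 / s := by
  unfold F
  rw [tsum_eq_single 0]
  · simp
  · intro n hn; simp [hn]

lemma F_deriv (s z : ℂ) : HasDerivAt (F s) (- F (s + 1) z) z := by
  obtain ⟨M, hM0, hM⟩ := bdd s
  set r : ℝ := ‖z‖ + 1
  have hr : 0 < r := by positivity
  have hsm : Summable (fun n : ℕ => M * (r ^ n / n.factorial)) :=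
    (Real.summable_pow_div_factorial r).mul_left M
  have hu : Summable (fun n : ℕ => M * (n * r ^ (n - 1) / n.factorial)) := by
    apply Summable.mul_left
    rw [← summable_nat_add_iff 1]
    refine (Real.summable_pow_div_factorial r).congr fun n => ?_
    rw [Nat.factorial_succ]; push_cast
    field_simp
  have := hasDerivAt_tsum_of_isPreconnected (𝕜 := ℂ)
    (g := fun (n : ℕ) (z : ℂ) => (-1) ^ n * z ^ n / ((Nat.factorial n : ℂ) * (s + n)))
    (g' := fun (n : ℕ) (z : ℂ) => (-1) ^ n * (n * z ^ (n - 1)) / ((Nat.factorial n : ℂ) * (s + n)))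
    (t := ball 0 r) (y₀ := 0) (y := z) hu isOpen_ball (convex_ball (0:ℂ) r).isPreconnected
    (fun n y _ => ((hasDerivAt_pow n y).const_mul _).div_const _)
    (fun n y hy => by
      have hy : ‖y‖ < r := by simpa using hy
      have : (-1) ^ n * (n * y ^ (n - 1)) / ((Nat.factorial n : ℂ) * (s + n)) =
        (s + n)⁻¹ * ((-1) ^ n * (n * y ^ (n - 1)) / n.factorial) := by
          rw [div_mul_eq_div_div, div_eq_mul_inv _ (s + n)]; ring
      rw [this, norm_mul]
      gcongr
      · exact hM n
      · simp only [norm_div, norm_mul, norm_pow, norm_neg, norm_one, one_pow, one_mul,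
          Complex.norm_natCast]
        gcongr)
    (mem_ball_self hr)
    (Summable.of_norm_bounded ((Real.summable_pow_div_factorial _).mul_left M) (term_le s M hM 0))
    (by simp [r])
  convert! this using 1
  rw [tsum_eq_zero_add']
  · simp only [F]
    rw [← tsum_neg]
    simp only [Nat.cast_zero, zero_mul, mul_zero, zero_div, zero_add]
    congr 1
    ext n
    rw [Nat.factorial_succ]
    push_cast
    rw [show s + ((n:ℂ) + 1) = s + 1 + n by ring, pow_succ]
    have : (n:ℂ) + 1 ≠ 0 := by exact_mod_cast Nat.succ_ne_zero n
    rw [← neg_div, show (-1:ℂ) ^ n * -1 * (((n:ℂ) + 1) * z ^ n) = (n + 1) * (-((-1) ^ n * z ^ n)) by ring,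
      mul_assoc, mul_div_mul_left _ _ this]
  · obtain ⟨M', hM0', hM'⟩ := bdd (s + 1)
    refine (Summable.of_norm_bounded ((Real.summable_pow_div_factorial _).mul_left M')
      (term_le (s+1) M' hM' z)).neg.congr fun n => ?_
    rw [Nat.factorial_succ]
    push_cast
    rw [show s + ((n:ℂ) + 1) = s + 1 + n by ring, pow_succ]
    have : (n:ℂ) + 1 ≠ 0 := by exact_mod_cast Nat.succ_ne_zero n
    rw [← neg_div, show (-1:ℂ) ^ n * -1 * (((n:ℂ) + 1) * z ^ n) = (n + 1) * (-((-1) ^ n * z ^ n)) by ring,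
      mul_assoc, mul_div_mul_left _ _ this]

end IncGamma

/-- Equation (3.2): for `s` not a nonpositive integer, the zeros `ρ` (of order `k_ρ`) of the
entire function `z ↦ ∑_{n≥0} (-1)^n z^n/(n!(s+n)) = z^{-s}γ(s,z)` satisfy
`∑_ρ k_ρ/ρ² = -s/((s+1)²(s+2))`. -/
theorem sum_inv_sq_zeros_incomplete_gamma_in_z (s : ℂ) (hs : ∀ n : ℕ, s ≠ -(n : ℂ))
    (f : ℂ → ℂ)
    (hf : f = fun z => ∑' n : ℕ, (-1) ^ n * z ^ n / ((Nat.factorial n : ℂ) * (s + n)))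
    (k : ℂ → ℕ)
    (hk : ∀ ρ : ℂ, f ρ = 0 → ∃ h : AnalyticAt ℂ f ρ, analyticOrderAt f ρ = (k ρ : ℕ∞)) :
    Summable (fun ρ : {ρ : ℂ // f ρ = 0} => (k ρ : ℂ) / (ρ : ℂ) ^ 2) ∧
    ∑' ρ : {ρ : ℂ // f ρ = 0}, (k ρ : ℂ) / (ρ : ℂ) ^ 2
      = -s / ((s + 1) ^ 2 * (s + 2)) := by
  have hF : f = IncGamma.F s := hf
  have s0 : s ≠ 0 := by simpa using hs 0
  have s1 : s + 1 ≠ 0 := by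
    intro h; apply hs 1; push_cast; linear_combination h
  have s2 : s + 2 ≠ 0 := by
    intro h; apply hs 2; push_cast; linear_combination h
  obtain ⟨M, -, hM⟩ := IncGamma.bdd s
  have hd : Differentiable ℂ f := by
    rw [hF]; exact fun z => (IncGamma.F_deriv s z).differentiableAt
  have hf0 : f 0 ≠ 0 := by rw [hF, IncGamma.F_zero]; simpa using s0
  have hmain := IncGamma.general f hd hf0 M (by rw [hF]; exact IncGamma.F_bound s M hM) k
    (fun ρ hρ => (hk ρ hρ).2)
  refine ⟨hmain.1, ?_⟩
  rw [hmain.2, hF]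
  have hl : logDeriv (IncGamma.F s) = fun z => - IncGamma.F (s + 1) z / IncGamma.F s z := by
    ext z; rw [logDeriv_apply, (IncGamma.F_deriv s z).deriv]
  rw [hF] at hf0
  have hdd := ((IncGamma.F_deriv (s + 1) 0).fun_neg).fun_div (IncGamma.F_deriv s 0) hf0
  rw [hl, hdd.deriv]
  simp only [IncGamma.F_zero]
  rw [show s + 1 + 1 = s + 2 by ring]
  field_simp
  ring
end
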